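/- arXiv:0711.5007 — 2 statements merged into one kernel-verified Lean document; each statement's English description precedes it below -/
import Mathlib

section
/- Let p be a prime, let G be a finite p-group, and let H_1, …, H_k be subgroups of G such that each index |G : H_j| is at most p^n and such that the intersection of all conjugates H_j^g, over all g ∈ G and 1 ≤ j ≤ k, is the trivial subgroup. Then for all but finitely many i, every element of H^i(G) is annihilated by p^n. -/
namespace CE

section bar
set_option linter.unusedSectionVars false
set_option linter.unnecessarySeqFocus false
variable {G : Type} [Group G] {P : Type} [AddCommGroup P]

/-- shift: prepend an argument -/
def sh (g : G) (f : List G → P) : List G → P := fun t => f (g :: t)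

/-- merge an element into the first argument -/
def mg (g : G) (f : List G → P) : List G → P
  | [] => f []
  | h :: l => f (g * h :: l)

/-- the b part of the bar differential -/
def bd : (List G → P) → List G → P
  | _, [] => 0
  | f, g :: l => mg g f l - bd (sh g f) l
termination_by _ l => l.length

/-- the a part of the bar differential -/
def ad (ρ : G →* AddMonoid.End P) (f : List G → P) : List G → P
  | [] => 0
  | g :: l => ρ g (f l)

/-- bar differential -/
def dG (ρ : G →* AddMonoid.End P) (f : List G → P) : List G → P := ad ρ f - bd f

@[simp] lemma bd_nil (f : List G → P) : bd f [] = 0 := by simp [bd]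
lemma bd_cons (f : List G → P) (g : G) (l : List G) :
    bd f (g :: l) = mg g f l - bd (sh g f) l := by rw [bd]

lemma bd_add (f f' : List G → P) : bd (f + f') = bd f + bd f' := by
  funext l
  induction l generalizing f f' with
  | nil => simp
  | cons g l ih =>
    have : sh g (f + f') = sh g f + sh g f' := rfl
    simp only [bd_cons, Pi.add_apply, this, ih]
    cases l <;> simp [mg] <;> abel

lemma bd_map {Q : Type} [AddCommGroup Q] (φ : P →+ Q) (f : List G → P) (l : List G) :
    bd (fun t => φ (f t)) l = φ (bd f l) := by
  induction l generalizing f with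
  | nil => simp
  | cons g l ih =>
    have : sh g (fun t => φ (f t)) = fun t => φ (sh g f t) := rfl
    simp only [bd_cons, this, ih, map_sub]
    cases l <;> simp [mg]

lemma bd_neg (f : List G → P) : bd (-f) = - bd f := by
  funext l
  exact bd_map (-(AddMonoidHom.id P)) f l

lemma bd_end (φ : AddMonoid.End P) (f : List G → P) (l : List G) :
    bd (fun t => φ (f t)) l = φ (bd f l) := bd_map (φ : P →+ P) f l

lemma bd_sub (f f' : List G → P) : bd (f - f') = bd f - bd f' := by
  rw [sub_eq_add_neg, bd_add, bd_neg, sub_eq_add_neg]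

lemma bd_zero : bd (0 : List G → P) = 0 := by
  have := bd_sub (0 : List G → P) 0
  simpa using this

lemma bd_mg (g : G) (f : List G → P) : bd (mg g f) = mg g (bd f) := by
  funext l
  cases l with
  | nil => simp [mg]
  | cons h l =>
    have h1 : mg h (mg g f) = mg (g * h) f := by
      funext t; cases t <;> simp [mg, mul_assoc]
    have h2 : sh h (mg g f) = sh (g * h) f := by
      funext t; simp [mg, sh]
    rw [bd_cons, h1, h2]; exact (bd_cons f (g * h) l).symm

lemma bd_bd (f : List G → P) : bd (bd f) = 0 := by
  funext l
  induction l generalizing f with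
  | nil => simp
  | cons g l ih =>
    have h1 : sh g (bd f) = mg g f - bd (sh g f) := by
      funext t; simp [sh, bd_cons]
    rw [bd_cons, h1, bd_sub, bd_mg]
    simp [ih]

variable (ρ : G →* AddMonoid.End P)

lemma ad_sub (f f' : List G → P) : ad ρ (f - f') = ad ρ f - ad ρ f' := by
  funext l; cases l <;> simp [ad]
lemma ad_add (f f' : List G → P) : ad ρ (f + f') = ad ρ f + ad ρ f' := by
  funext l; cases l <;> simp [ad]

lemma bd_ad (f : List G → P) : bd (ad ρ f) = ad ρ (ad ρ f) - ad ρ (bd f) := by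
  funext l
  cases l with
  | nil => simp [ad]
  | cons g l =>
    have h1 : sh g (ad ρ f) = fun t => ρ g (f t) := rfl
    rw [bd_cons, h1, bd_end (ρ g)]
    cases l <;> simp [ad, mg]

lemma dG_add (f f' : List G → P) : dG ρ (f + f') = dG ρ f + dG ρ f' := by
  simp only [dG, bd_add, ad_add]; abel
lemma dG_sub (f f' : List G → P) : dG ρ (f - f') = dG ρ f - dG ρ f' := by
  simp only [dG, bd_sub, ad_sub]; abel

lemma dG_dG (f : List G → P) : dG ρ (dG ρ f) = 0 := by
  simp only [dG, bd_sub, ad_sub, bd_ad, bd_bd]; abel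

lemma dG_map {Q : Type} [AddCommGroup Q] (σ : G →* AddMonoid.End Q) (φ : P →+ Q)
    (hφ : ∀ g x, φ (ρ g x) = σ g (φ x)) (f : List G → P) (l : List G) :
    dG σ (fun t => φ (f t)) l = φ (dG ρ f l) := by
  simp only [dG, Pi.sub_apply, bd_map, map_sub]
  cases l <;> simp [ad, hφ]

/-- sign twist by length -/
def tw (f : List G → P) : List G → P := fun l => (-1 : ℤ) ^ l.length • f l

lemma tw_tw (f : List G → P) : tw (tw f) = f := by
  funext l; simp only [tw, smul_smul, ← mul_pow]; simp

lemma bd_tw (f : List G → P) : bd (tw f) = - tw (bd f) := by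
  funext l
  induction l generalizing f with
  | nil => simp [tw]
  | cons g l ih =>
    have h1 : sh g (tw f) = - tw (sh g f) := by
      funext t; simp [sh, tw, pow_succ]
    have h2 : mg g (tw f) l = tw (mg g f) l := by cases l <;> simp [mg, tw]
    rw [bd_cons, h1, bd_neg]
    simp only [Pi.neg_apply, ih, h2]
    simp only [tw, bd_cons, List.length_cons, pow_succ, smul_sub]
    simp; abel

lemma dG_tw (f : List G → P) : dG ρ (tw f) = - tw (dG ρ f) := by
  funext l
  simp only [dG, bd_tw]
  cases l with
  | nil => simp [ad, tw]
  | cons g l => simp [ad, tw, pow_succ, smul_sub]; abel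

lemma bd_comap {A : Type} [Group A] (φ : G →* A) (f : List A → P) (l : List G) :
    bd (fun t => f (t.map φ)) l = bd f (l.map φ) := by
  induction l generalizing f with
  | nil => simp
  | cons g l ih =>
    have : sh g (fun t : List G => f (t.map φ)) = fun t => sh (φ g) f (t.map φ) := rfl
    simp only [bd_cons, this, ih, List.map_cons]
    cases l <;> simp [mg]

/-- d depends only on values on lists of length one less -/
lemma bd_congr (f f' : List G → P) (l : List G)
    (h : ∀ t : List G, t.length + 1 = l.length → f t = f' t) : bd f l = bd f' l := by
  induction l generalizing f f' with
  | nil => simp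
  | cons g l ih =>
    rw [bd_cons, bd_cons, ih (sh g f) (sh g f')]
    · cases l with
      | nil => simp [mg, h]
      | cons a l => simp [mg, h]
    · intro t ht; exact h _ (by simp [ht])

lemma dG_congr (f f' : List G → P) (l : List G)
    (h : ∀ t : List G, t.length + 1 = l.length → f t = f' t) : dG ρ f l = dG ρ f' l := by
  simp only [dG, Pi.sub_apply, bd_congr f f' l h]
  cases l with
  | nil => simp [ad]
  | cons g l => simp [ad, h l rfl]

/-- cup product on the left with an integer cochain -/
def cup (ρ : G →* AddMonoid.End P) (f : List G → P) : (List G → ℤ) → List G → P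
  | z, [] => z [] • f []
  | z, g :: l => z [] • f (g :: l) + ρ g (cup ρ f (sh g z) l)
termination_by _ l => l.length

lemma cup_nil (f : List G → P) (z : List G → ℤ) : cup ρ f z [] = z [] • f [] := by rw [cup]
lemma cup_cons (f : List G → P) (z : List G → ℤ) (g : G) (l : List G) :
    cup ρ f z (g :: l) = z [] • f (g :: l) + ρ g (cup ρ f (sh g z) l) := by rw [cup]

lemma cup_sub (f : List G → P) (z z' : List G → ℤ) (l : List G) :
    cup ρ f (z - z') l = cup ρ f z l - cup ρ f z' l := by
  induction l generalizing z z' with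
  | nil => simp [cup_nil, sub_smul]
  | cons g l ih =>
    have : sh g (z - z') = sh g z - sh g z' := rfl
    simp only [cup_cons, this, ih, Pi.sub_apply, sub_smul, map_sub]; abel

lemma cup_mg (f : List G → P) (z : List G → ℤ) (g : G) (l : List G) :
    mg g (cup ρ f z) l = z [] • mg g f l + ρ g (cup ρ f (mg g z) l) - z [] • ρ g (f l) := by
  cases l with
  | nil => simp [mg, cup_nil]
  | cons h l =>
    have : sh h (mg g z) = sh (g * h) z := by funext t; rfl
    simp [mg, cup_cons, this]; abel

lemma bd_cup (f : List G → P) (z : List G → ℤ) (l : List G) :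
    bd (cup ρ f z) l = cup ρ f (bd z) l - cup ρ (dG ρ f) (tw z) l := by
  induction l generalizing z with
  | nil => simp [cup_nil, dG, ad]
  | cons g l ih =>
    have h1 : sh g (cup ρ f z) = (fun t => z [] • sh g f t) + fun t => ρ g (cup ρ f (sh g z) t) := by
      funext t; simp [sh, cup_cons]
    have h2 : bd (fun t => z [] • sh g f t) l = z [] • bd (sh g f) l :=
      bd_map (DistribSMul.toAddMonoidHom P (z [])) (sh g f) l
    have h3 : sh g (bd z) = mg g z - bd (sh g z) := by funext t; simp [sh, bd_cons]
    have h4 : sh g (tw z) = 0 - tw (sh g z) := by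
      funext t; simp [sh, tw, pow_succ]
    have h0 : cup ρ (dG ρ f) 0 l = 0 := by
      have := cup_sub ρ (dG ρ f) 0 0 l; simpa using this
    rw [bd_cons, h1, bd_add, Pi.add_apply, h2, bd_end (ρ g), ih, cup_mg, cup_cons, cup_cons, h3, h4,
      cup_sub, cup_sub, h0]
    simp [dG, ad, tw, bd_cons, smul_sub]
    abel

lemma ad_cup (f : List G → P) (z : List G → ℤ) :
    ad ρ (cup ρ f z) = cup ρ f (ad 1 z) := by
  funext l
  cases l with
  | nil => simp [ad, cup_nil]
  | cons g l =>
    have : sh g (ad 1 z) = z := by funext t; simp [sh, ad]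
    simp [cup_cons, this, ad]

lemma dG_cup (f : List G → P) (z : List G → ℤ) (hz : dG 1 z = 0) :
    dG ρ (cup ρ f z) = cup ρ (dG ρ f) (tw z) := by
  have h : bd z = ad 1 z := by
    have := hz; rw [dG, sub_eq_zero] at this; exact this.symm
  funext l
  conv_lhs => rw [dG]
  rw [Pi.sub_apply, bd_cup, ad_cup, h]; abel

/-- concentrated in length zero -/
def sgl (k : P) : List G → P
  | [] => k
  | _ :: _ => 0

lemma cup_sgl (k : P) (hk : ∀ g, ρ g k = k) (z : List G → ℤ) (l : List G) :
    cup ρ (sgl k) z l = z l • k := by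
  induction l generalizing z with
  | nil => simp [cup_nil, sgl]
  | cons g l ih => simp [cup_cons, sgl, ih, sh, hk]

end bar
end CE


namespace CE

section tot
set_option linter.unusedSectionVars false
variable {G : Type} [Group G] {K : Type} [AddCommGroup K]

/-- total differential -/
def dt (ρ : G →* AddMonoid.End K) (D : AddMonoid.End K) (f : List G → K) : List G → K :=
  dG ρ f + tw (fun l => D (f l))

/-- graded dg G-module, contractible onto the integers. -/
structure DGM (G K : Type) [Group G] [AddCommGroup K] where
  ρ : G →* AddMonoid.End K
  D : AddMonoid.End K
  DD : ∀ x, D (D x) = 0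
  Dρ : ∀ g x, D (ρ g x) = ρ g (D x)
  pr : ℕ → AddMonoid.End K
  prρ : ∀ n g x, pr n (ρ g x) = ρ g (pr n x)
  prD : ∀ n x, pr (n + 1) (D x) = D (pr n x)
  prD0 : ∀ x, pr 0 (D x) = 0
  prpr : ∀ m n x, pr m (pr n x) = if m = n then pr n x else 0
  pr_ext : ∀ x, (∀ m, pr m x = 0) → x = 0
  pr_bdd : ∀ x, ∃ N, ∀ m, N ≤ m → pr m x = 0
  η : K
  ρη : ∀ g, ρ g η = η
  Dη : D η = 0
  prη : pr 0 η = η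
  prη' : ∀ n, pr (n + 1) η = 0
  ε : K →+ ℤ
  εη : ε η = 1
  S : AddMonoid.End K
  prS : ∀ n x, pr n (S x) = S (pr (n + 1) x)
  hS : ∀ x, x = ε x • η + D (S x) + S (D x)

lemma dt_add (ρ : G →* AddMonoid.End K) (D : AddMonoid.End K) (f f' : List G → K) :
    dt ρ D (f + f') = dt ρ D f + dt ρ D f' := by
  funext l; simp [dt, dG_add, tw]; abel
lemma dt_sub (ρ : G →* AddMonoid.End K) (D : AddMonoid.End K) (f f' : List G → K) :
    dt ρ D (f - f') = dt ρ D f - dt ρ D f' := by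
  funext l; simp [dt, dG_sub, tw, smul_sub]; abel

lemma dt_dt (M : DGM G K) (f : List G → K) : dt M.ρ M.D (dt M.ρ M.D f) = 0 := by
  have h1 : (fun l => M.D (dt M.ρ M.D f l)) = fun l => M.D (dG M.ρ f l) := by
    funext l; simp [dt, tw, M.DD]
  have h2 : dG M.ρ (fun l => M.D (f l)) = fun l => M.D (dG M.ρ f l) := by
    funext l; exact dG_map M.ρ M.ρ M.D M.Dρ f l
  conv_lhs => rw [dt, h1]
  rw [dt, dG_add, dG_dG, dG_tw, h2]; abel

/-- Projection to total degree i -/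
def Pr (M : DGM G K) (i : ℕ) (f : List G → K) : List G → K :=
  fun l => if l.length ≤ i then M.pr (i - l.length) (f l) else 0

lemma dG_zero' (ρ : G →* AddMonoid.End K) : dG ρ (0 : List G → K) = 0 := by
  have := dG_sub ρ (0 : List G → K) 0; simpa using this

lemma dG_end (ρ : G →* AddMonoid.End K) (φ : AddMonoid.End K)
    (hφ : ∀ g x, φ (ρ g x) = ρ g (φ x)) (f : List G → K) (l : List G) :
    dG ρ (fun t => φ (f t)) l = φ (dG ρ f l) := dG_map ρ ρ φ hφ f l

lemma Pr_dt (M : DGM G K) (i : ℕ) (f : List G → K) :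
    dt M.ρ M.D (Pr M i f) = Pr M (i + 1) (dt M.ρ M.D f) := by
  funext l
  simp only [dt, Pi.add_apply, tw]
  have e1 : dG M.ρ (Pr M i f) l = Pr M (i + 1) (dG M.ρ f) l := by
    by_cases hl : l.length ≤ i + 1
    · have : Pr M (i + 1) (dG M.ρ f) l = M.pr (i + 1 - l.length) (dG M.ρ f l) := by
        simp [Pr, hl]
      rw [this, ← dG_end M.ρ (M.pr (i + 1 - l.length)) (M.prρ _) f l]
      apply dG_congr
      intro t ht
      have h1 : t.length ≤ i := by omega
      have h2 : i + 1 - l.length = i - t.length := by omega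
      simp only [Pr, h1, if_true, h2]
    · have : Pr M (i + 1) (dG M.ρ f) l = 0 := by simp [Pr, hl]
      rw [this, dG_congr M.ρ _ 0, dG_zero']; rfl
      intro t ht
      have h1 : ¬ t.length ≤ i := by omega
      simp [Pr, h1]
  rw [e1]
  simp only [Pr]
  by_cases hl : l.length ≤ i
  · have h1 : l.length ≤ i + 1 := by omega
    have h2 : i + 1 - l.length = (i - l.length) + 1 := by omega
    simp [hl, h1, h2, tw, M.prD]
  · by_cases h1 : l.length ≤ i + 1
    · have h2 : i + 1 - l.length = 0 := by omega
      simp [hl, h1, h2, tw, M.prD0]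
    · simp [hl, h1]

/-- key reduction: push everything onto the unit -/
lemma reduce (M : DGM G K) (n : ℕ) (f : List G → K)
    (hf : ∀ l m, n < m → M.pr m (f l) = 0)
    (hd : ∀ l m, 0 < m → M.pr m (dt M.ρ M.D f l) = 0) :
    ∃ (h : List G → K) (z : List G → ℤ), f = dt M.ρ M.D h + fun l => z l • M.η := by
  have key : ∀ f : List G → K, (∀ l m, 0 < m → M.pr m (dt M.ρ M.D f l) = 0) →
      ∀ l, f l = M.ε (f l) • M.η + M.D (M.S (f l)) + (-1 : ℤ) ^ l.length •
        (M.S (dt M.ρ M.D f l) - M.S (dG M.ρ f l)) := by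
    intro f _ l
    conv_lhs => rw [M.hS (f l)]
    congr 1
    rw [← map_sub]
    have : dt M.ρ M.D f l - dG M.ρ f l = (-1 : ℤ) ^ l.length • M.D (f l) := by simp [dt, tw]
    rw [this, map_zsmul, smul_smul, ← mul_pow]; simp
  have hS0 : ∀ x, (∀ m, 0 < m → M.pr m x = 0) → M.S x = 0 := by
    intro x hx
    apply M.pr_ext; intro m
    rw [M.prS, hx _ (Nat.succ_pos m), map_zero]
  have hdG : ∀ (n : ℕ) (f : List G → K), (∀ l m, n < m → M.pr m (f l) = 0) →
      ∀ l m, n < m → M.pr m (dG M.ρ f l) = 0 := by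
    intro n f hf l m hm
    rw [← dG_end M.ρ (M.pr m) (M.prρ m) f l]
    have : (fun t => M.pr m (f t)) = 0 := by funext t; exact hf t m hm
    exact (congrFun (congrArg (dG M.ρ) this) l).trans (by rw [dG_zero']; rfl)
  induction n generalizing f with
  | zero =>
    refine ⟨0, fun l => M.ε (f l), ?_⟩
    have h0 : dt M.ρ M.D (0 : List G → K) = 0 := by
      have := dt_sub M.ρ M.D (0 : List G → K) 0; simpa using this
    rw [h0, zero_add]
    funext l
    conv_lhs => rw [key f hd l]
    rw [hS0 _ (hf l), hS0 _ (hd l), hS0 _ (hdG 0 f hf l)]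
    simp
  | succ n ih =>
    set h : List G → K := tw (fun l => M.S (f l)) with hh
    have hf'd : dt M.ρ M.D (f - dt M.ρ M.D h) = dt M.ρ M.D f := by
      rw [dt_sub, dt_dt, sub_zero]
    have hval : ∀ l, (f - dt M.ρ M.D h) l = M.ε (f l) • M.η + (-1 : ℤ) ^ l.length •
        (M.S (dt M.ρ M.D f l) - M.S (dG M.ρ f l)) - dG M.ρ h l := by
      intro l
      have e : tw (fun l => M.D (h l)) l = M.D (M.S (f l)) := by
        simp [tw, hh, smul_smul, ← mul_pow]
      have := key f hd l
      rw [Pi.sub_apply, dt, Pi.add_apply, e, sub_eq_iff_eq_add]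
      refine this.trans ?_
      abel
    have hh' : ∀ l m, n < m → M.pr m (h l) = 0 := by
      intro l m hm
      simp only [hh, tw, map_zsmul]
      rw [M.prS, hf l _ (by omega)]; simp
    obtain ⟨h', z, hz⟩ := ih (f - dt M.ρ M.D h) (by
      intro l m hm
      rw [hval]
      obtain ⟨m, rfl⟩ : ∃ k, m = k + 1 := ⟨m - 1, by omega⟩
      simp only [map_sub, map_add, map_zsmul, M.prη', M.prS]
      rw [hd l _ (by omega), hdG (n + 1) f hf l _ (by omega), hdG n h hh' l _ hm]
      simp) (by rw [hf'd]; exact hd)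
    refine ⟨h + h', z, ?_⟩
    rw [dt_add, add_assoc, ← hz]; abel

lemma dG_η (M : DGM G K) (z : List G → ℤ) (l : List G) :
    dG M.ρ (fun l => z l • M.η) l = dG 1 z l • M.η := by
  exact dG_map (1 : G →* AddMonoid.End ℤ) M.ρ
    (zmultiplesHom K M.η)
    (by intro g x; simp [M.ρη]) z l

lemma dt_η (M : DGM G K) (z : List G → ℤ) (l : List G) :
    dt M.ρ M.D (fun l => z l • M.η) l = dG 1 z l • M.η := by
  simp [dt, dG_η, tw, M.Dη]

lemma smul_η_inj (M : DGM G K) {a b : ℤ} (h : a • M.η = b • M.η) : a = b := by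
  have := congrArg M.ε h
  simpa [M.εη] using this

/-- injectivity of the unit -/
lemma unit_inj (M : DGM G K) (i : ℕ) (z : List G → ℤ) (hz : ∀ l, l.length ≠ i + 1 → z l = 0)
    (h : List G → K) (hh : (fun l => z l • M.η) = dt M.ρ M.D h) :
    ∃ w : List G → ℤ, z = dG 1 w := by
  have e : Pr M (i + 1) (fun l => z l • M.η) = fun l => z l • M.η := by
    funext l
    by_cases hl : l.length = i + 1
    · simp [Pr, hl, M.prη]
    · simp [Pr, hz l hl]
  have e2 : dt M.ρ M.D (Pr M i h) = fun l => z l • M.η := by rw [Pr_dt, ← hh, e]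
  obtain ⟨h', w, hw⟩ := reduce M i (Pr M i h) (by
    intro l m hm
    simp only [Pr]
    split_ifs
    · rw [M.prpr, if_neg (by omega)]
    · simp) (by
    intro l m hm
    obtain ⟨m, rfl⟩ : ∃ k, m = k + 1 := ⟨m - 1, by omega⟩
    rw [e2]; simp [M.prη'])
  refine ⟨w, ?_⟩
  funext l
  apply smul_η_inj M
  rw [← dt_η]
  have : dt M.ρ M.D (Pr M i h) = dt M.ρ M.D fun l => w l • M.η := by
    rw [hw, dt_add, dt_dt, zero_add]
  rw [← this, e2]

lemma dt_sgl (M : DGM G K) (k : K) (hk : ∀ g, M.ρ g k = k) (hD : M.D k = 0) :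
    dt M.ρ M.D (sgl k) = 0 := by
  have hb : ∀ l : List G, bd (0 : List G → K) l = 0 := fun l => by rw [bd_zero]; rfl
  funext l
  rcases l with _ | ⟨g, _ | ⟨h, l⟩⟩
  · simp [dt, dG, ad, tw, sgl, hD]
  · simp [dt, dG, ad, tw, sgl, bd_cons, mg, hk]
  · have : sh g (sgl k) = 0 := rfl
    simp [dt, dG, ad, tw, sgl, bd_cons (sgl k), mg, this, hb]

/-- surjectivity of the unit -/
lemma unit_surj (M : DGM G K) (k : K) (hk : ∀ g, M.ρ g k = k) (hD : M.D k = 0) :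
    ∃ (h : List G → K) (z : List G → ℤ), sgl k = dt M.ρ M.D h + (fun l => z l • M.η) ∧
      dG 1 z = 0 := by
  obtain ⟨N, hN⟩ := M.pr_bdd k
  obtain ⟨h, z, hz⟩ := reduce M N (sgl k) (by
    intro l m hm
    cases l
    · simp [sgl, hN m hm.le]
    · simp [sgl]) (by simp [dt_sgl M k hk hD])
  refine ⟨h, z, hz, ?_⟩
  funext l
  apply smul_η_inj M
  rw [← dt_η]
  have := congrArg (dt M.ρ M.D) hz
  rw [dt_sgl M k hk hD, dt_add, dt_dt, zero_add] at this
  rw [← this]; simp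

/-- freeness: relative trace -/
def IsFree [Fintype G] (ρ : G →* AddMonoid.End K) : Prop :=
  ∃ θ : AddMonoid.End K, ∀ x, ∑ g : G, ρ g (θ (ρ g⁻¹ x)) = x

/-- contraction in the group direction -/
def hG [Fintype G] (ρ : G →* AddMonoid.End K) (θ : AddMonoid.End K) (f : List G → K) :
    List G → K := fun l => ∑ g : G, ρ g (θ (f (g⁻¹ :: l)))

lemma bd_sum {ι : Type} (s : Finset ι) (f : ι → List G → K) (l : List G) :
    bd (fun t => ∑ i ∈ s, f i t) l = ∑ i ∈ s, bd (f i) l := by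
  classical
  induction s using Finset.induction_on with
  | empty => exact congrFun (bd_zero (G := G) (P := K)) l
  | insert a s ha ih =>
    simp only [Finset.sum_insert ha]
    have := congrFun (bd_add (f a) (fun t => ∑ i ∈ s, f i t)) l
    rw [Pi.add_apply, ih] at this
    exact this

lemma hG_spec [Fintype G] (ρ : G →* AddMonoid.End K) (θ : AddMonoid.End K)
    (hθ : ∀ x, ∑ g : G, ρ g (θ (ρ g⁻¹ x)) = x) (f : List G → K) (l : List G) (hl : l ≠ []) :
    dG ρ (hG ρ θ f) l + hG ρ θ (dG ρ f) l = f l := by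
  obtain ⟨g, l, rfl⟩ := List.exists_cons_of_ne_nil hl
  have e1 : bd (hG ρ θ f) (g :: l) = ∑ x : G, ρ x (θ (bd (sh x⁻¹ f) (g :: l))) := by
    have : hG ρ θ f = fun t => ∑ x : G, (fun x t => ρ x (θ (sh x⁻¹ f t))) x t := rfl
    rw [this, bd_sum]
    refine Finset.sum_congr rfl fun x _ => ?_
    exact bd_end (ρ x * θ) (sh x⁻¹ f) (g :: l)
  have e2 : ad ρ (hG ρ θ f) (g :: l) = ∑ x : G, ρ x (θ (mg x⁻¹ f (g :: l))) := by
    simp only [ad, hG, map_sum, mg]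
    rw [← Equiv.sum_comp (Equiv.mulLeft g)
      (fun x => ρ x (θ (f (x⁻¹ * g :: l))))]
    refine Finset.sum_congr rfl fun x _ => ?_
    simp [map_mul]
  have e3 : hG ρ θ (dG ρ f) (g :: l) = f (g :: l) - ∑ x : G, ρ x (θ (mg x⁻¹ f (g :: l)))
      + ∑ x : G, ρ x (θ (bd (sh x⁻¹ f) (g :: l))) := by
    conv_rhs => rw [← hθ (f (g :: l))]
    rw [← Finset.sum_sub_distrib, ← Finset.sum_add_distrib]
    refine Finset.sum_congr rfl fun x _ => ?_
    simp only [dG, Pi.sub_apply, bd_cons f, map_sub, ad]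
    abel
  rw [dG, Pi.sub_apply, e1, e2, e3]; abel

lemma invar (M : DGM G K) [Fintype G] (hF : IsFree M.ρ) (n : ℕ) (f : List G → K)
    (hf : ∀ l, n < l.length → f l = 0) (hd : dt M.ρ M.D f = 0) :
    ∃ (h : List G → K) (k : K), (∀ g, M.ρ g k = k) ∧ M.D k = 0 ∧ f = dt M.ρ M.D h + sgl k := by
  obtain ⟨θ, hθ⟩ := hF
  induction n generalizing f with
  | zero =>
    have e : f = sgl (f []) := by
      funext l; cases l with
      | nil => rfl
      | cons a l => exact hf _ (by simp)
    refine ⟨0, f [], ?_, ?_, ?_⟩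
    · intro g
      have := congrFun hd [g]
      simp [dt, dG, ad, bd_cons, mg, tw, hf [g]] at this
      exact sub_eq_zero.mp this
    · have := congrFun hd []
      simpa [dt, dG, ad, tw] using this
    · have h0 : dt M.ρ M.D (0 : List G → K) = 0 := by
        have := dt_sub M.ρ M.D (0 : List G → K) 0; simpa using this
      rw [h0, zero_add]; exact e
  | succ n ih =>
    set h := hG M.ρ θ f with hh
    obtain ⟨h', k, h1, h2, h3⟩ := ih (f - dt M.ρ M.D h) (by
      intro l hl
      have hne : l ≠ [] := by rintro rfl; simp at hl
      have h0 := hG_spec M.ρ θ hθ f l hne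
      have hz : h l = 0 := by
        simp only [hh, hG]
        refine Finset.sum_eq_zero fun x _ => ?_
        rw [hf _ (by simpa using hl)]; simp
      have hz2 : hG M.ρ θ (dG M.ρ f) l = 0 := by
        simp only [hG]
        refine Finset.sum_eq_zero fun x _ => ?_
        have := congrFun hd (x⁻¹ :: l)
        simp only [dt, Pi.add_apply, tw] at this
        rw [hf (x⁻¹ :: l) (by simpa using hl)] at this
        simp at this
        rw [this]; simp
      rw [hz2, add_zero] at h0
      simp [dt, tw, hz, ← hh ▸ h0]) (by rw [dt_sub, dt_dt, hd, sub_zero])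
    refine ⟨h + h', k, h1, h2, ?_⟩
    rw [dt_add, add_assoc, ← h3]; abel

lemma cup_tw (M : DGM G K) (f : List G → K) (z : List G → ℤ) (l : List G) :
    (-1 : ℤ) ^ l.length • M.D (cup M.ρ f z l) = cup M.ρ (tw fun l => M.D (f l)) (tw z) l := by
  have hneg : ∀ (f : List G → K) (z : List G → ℤ) l, cup M.ρ f (-z) l = - cup M.ρ f z l := by
    intro f z l
    have h := cup_sub M.ρ f 0 z l
    have h0 := cup_sub M.ρ f 0 0 l
    simp at h0 h
    rw [h, h0]; simp
  induction l generalizing z with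
  | nil => simp [cup_nil, tw]
  | cons g l ih =>
    have : sh g (tw z) = - tw (sh g z) := by
      funext t; simp [sh, tw, pow_succ]
    rw [cup_cons, cup_cons, this, hneg, ← ih]
    simp [tw, M.Dρ, pow_succ, smul_add]
    rw [smul_comm]

lemma cup_add_left (ρ : G →* AddMonoid.End K) (f f' : List G → K) (z : List G → ℤ) (l : List G) :
    cup ρ (f + f') z l = cup ρ f z l + cup ρ f' z l := by
  induction l generalizing z with
  | nil => simp [cup_nil]
  | cons g l ih => simp [cup_cons, ih]; abel

lemma dt_cup (M : DGM G K) (f : List G → K) (z : List G → ℤ) (hz : dG 1 z = 0) :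
    dt M.ρ M.D (cup M.ρ f z) = cup M.ρ (dt M.ρ M.D f) (tw z) := by
  funext l
  rw [dt, Pi.add_apply, dG_cup M.ρ f z hz, tw, cup_tw, dt, cup_add_left]

/-- if an invariant element is a total coboundary then so is its product with any cocycle -/
lemma kill_cup (M : DGM G K) (k : K) (hk : ∀ g, M.ρ g k = k) (f : List G → K)
    (hf : sgl k = dt M.ρ M.D f) (z : List G → ℤ) (hz : dG 1 z = 0) :
    ∃ h, (fun l => z l • k) = dt M.ρ M.D h := by
  refine ⟨cup M.ρ f (tw z), ?_⟩
  rw [dt_cup _ _ _ (by rw [dG_tw, hz]; funext l; simp [tw]), tw_tw, ← hf]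
  funext l
  rw [cup_sgl M.ρ k hk]

end tot
end CE


namespace CE

section ev
set_option linter.unusedSectionVars false
variable {G : Type} [Group G] {K : Type} [AddCommGroup K]

/-- eventually annihilated by q (concrete version) -/
def Ev (G : Type) [Group G] (q : ℤ) : Prop :=
  ∃ d : ℕ, ∀ i, d ≤ i → ∀ z : List G → ℤ, (∀ l, l.length ≠ i → z l = 0) → dG 1 z = 0 →
    ∃ w : List G → ℤ, q • z = dG 1 w

/-- restriction to a given length -/
def res (N : ℕ) (z : List G → ℤ) : List G → ℤ := fun l => if l.length = N then z l else 0

lemma dG_res (N : ℕ) (z : List G → ℤ) : dG 1 (res N z) = res (N + 1) (dG 1 z) := by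
  funext l
  by_cases hl : l.length = N + 1
  · simp only [res, hl, if_true]
    apply dG_congr
    intro t ht
    simp [res, show t.length = N by omega]
  · simp only [res, hl, if_false]
    rw [dG_congr 1 _ 0, dG_zero']; rfl
    intro t ht
    simp [res, show t.length ≠ N by omega]

lemma dt_zsmul (ρ : G →* AddMonoid.End K) (D : AddMonoid.End K) (q : ℤ) (f : List G → K) :
    dt ρ D (q • f) = q • dt ρ D f := by
  let φ : (List G → K) →+ (List G → K) := AddMonoidHom.mk' (dt ρ D) (dt_add ρ D)
  exact map_zsmul φ q f

lemma dt_sum (ρ : G →* AddMonoid.End K) (D : AddMonoid.End K) {ι : Type} (s : Finset ι)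
    (f : ι → List G → K) :
    dt ρ D (∑ i ∈ s, f i) = ∑ i ∈ s, dt ρ D (f i) := by
  let φ : (List G → K) →+ (List G → K) := AddMonoidHom.mk' (dt ρ D) (dt_add ρ D)
  exact map_sum φ f s

lemma dt_end (ρ : G →* AddMonoid.End K) (D : AddMonoid.End K) (φ : AddMonoid.End K)
    (hφ : ∀ g x, φ (ρ g x) = ρ g (φ x)) (hD : ∀ x, φ (D x) = D (φ x)) (f : List G → K) :
    dt ρ D (fun t => φ (f t)) = fun t => φ (dt ρ D f t) := by
  funext l
  simp [dt, tw, dG_end ρ φ hφ, hD]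

lemma Pr_sgl (M : DGM G K) (N : ℕ) (k : K) : Pr M N (sgl k) = sgl (M.pr N k) := by
  funext l
  cases l <;> simp [Pr, sgl]

lemma Pr_add (M : DGM G K) (N : ℕ) (f f' : List G → K) :
    Pr M N (f + f') = Pr M N f + Pr M N f' := by
  funext l
  simp only [Pr, Pi.add_apply]; split_ifs <;> simp

lemma Pr_sum (M : DGM G K) (N : ℕ) {ι : Type} (s : Finset ι)
    (f : ι → List G → K) : Pr M N (∑ i ∈ s, f i) = ∑ i ∈ s, Pr M N (f i) := by
  let φ : (List G → K) →+ (List G → K) := AddMonoidHom.mk' (Pr M N) (Pr_add M N)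
  exact map_sum φ f s

lemma Pr_η (M : DGM G K) (N : ℕ) (z : List G → ℤ) :
    Pr M N (fun l => z l • M.η) = fun l => res N z l • M.η := by
  funext l
  by_cases h : l.length = N
  · simp [Pr, res, h, M.prη]
  · by_cases h' : l.length ≤ N
    · obtain ⟨m, hm⟩ : ∃ m, N - l.length = m + 1 := ⟨N - l.length - 1, by omega⟩
      simp [Pr, res, h, h', hm, M.prη']
    · simp [Pr, res, h, h']

lemma sgl_zsmul (q : ℤ) (k : K) : (sgl (q • k) : List G → K) = q • sgl k := by
  funext l; cases l <;> simp [sgl]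

lemma kill_of_ev (M : DGM G K) (q : ℤ) {d : ℕ}
    (hd : ∀ i, d ≤ i → ∀ z : List G → ℤ, (∀ l, l.length ≠ i → z l = 0) → dG 1 z = 0 →
      ∃ w : List G → ℤ, q • z = dG 1 w)
    (N : ℕ) (hN : d ≤ N + 1) (k : K) (hk : ∀ g, M.ρ g k = k) (hD : M.D k = 0)
    (hkN : M.pr (N + 1) k = k) : ∃ f, (sgl (q • k) : List G → K) = dt M.ρ M.D f := by
  obtain ⟨h, z, e, hz⟩ := unit_surj M k hk hD
  have e1 := congrArg (Pr M (N + 1)) e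
  rw [Pr_sgl, hkN, Pr_add, ← Pr_dt, Pr_η] at e1
  obtain ⟨w, hw⟩ := hd (N + 1) hN (res (N + 1) z) (by intro l hl; simp [res, hl])
    (by rw [dG_res, hz]; funext l; simp [res])
  refine ⟨q • Pr M N h + fun l => w l • M.η, ?_⟩
  rw [sgl_zsmul, e1, dt_add, smul_add, dt_zsmul]
  congr 1
  funext l
  rw [dt_η, ← hw]
  simp [smul_smul]

theorem ev_of_dgm [Fintype G] (M : DGM G K) (hF : IsFree M.ρ) (q : ℤ) {I : Type} [Fintype I]
    (R : I → AddMonoid.End K) (hRρ : ∀ k g x, R k (M.ρ g x) = M.ρ g (R k x))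
    (hRD : ∀ k x, R k (M.D x) = M.D (R k x))
    (hkill : ∀ k, ∃ f, (sgl (q • R k M.η) : List G → K) = dt M.ρ M.D f)
    (N : ℕ)
    (hfin : ∀ ζ, (∀ g, M.ρ g ζ = ζ) → M.D ζ = 0 → ∃ ζ0, (∀ m, N ≤ m → M.pr m ζ0 = 0) ∧
      ∃ ζs : I → K, (∀ k, (∀ g, M.ρ g (ζs k) = ζs k) ∧ M.D (ζs k) = 0) ∧
        ζ = ζ0 + ∑ k, R k (ζs k)) : Ev G q := by
  refine ⟨N + 1, ?_⟩
  rintro (_ | i) hi z hz hdz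
  · omega
  obtain ⟨h, ζ, hρ, hD, e⟩ := invar M hF (i + 1) (fun l => z l • M.η)
    (by intro l hl; simp [hz l (by omega)]) (by funext l; rw [dt_η, hdz]; simp)
  obtain ⟨ζ0, hζ0, ζs, hζs, eζ⟩ := hfin ζ hρ hD
  have hk : ∀ k, ∃ f, (sgl (q • R k (ζs k)) : List G → K) = dt M.ρ M.D f := by
    intro k
    obtain ⟨h, z, e, hz⟩ := unit_surj M (ζs k) (hζs k).1 (hζs k).2
    obtain ⟨f, hf⟩ := hkill k
    obtain ⟨h2, hh2⟩ := kill_cup M (q • R k M.η) (by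
      intro g; rw [map_zsmul, ← hRρ, M.ρη]) f hf z hz
    refine ⟨q • (fun l => R k (h l)) + h2, ?_⟩
    rw [dt_add, ← hh2, dt_zsmul, dt_end _ _ _ (hRρ k) (hRD k)]
    funext l
    have := congrArg (fun x => q • R k x) (congrFun e l)
    simp only [Pi.add_apply, map_add, smul_add, map_zsmul] at this
    simp only [Pi.add_apply, Pi.smul_apply]
    rw [smul_comm (z l) q, ← this]
    cases l <;> simp [sgl]
  choose f hf using hk
  have eq1 : (fun l => z l • M.η) = dt M.ρ M.D (Pr M i h) + Pr M (i + 1) (sgl ζ) := by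
    rw [Pr_dt, ← Pr_add, ← e, Pr_η]
    funext l
    by_cases hl : l.length = i + 1
    · simp [res, hl]
    · simp [res, hl, hz l hl]
  have eq2 : q • Pr M (i + 1) (sgl ζ) = dt M.ρ M.D (∑ k, Pr M i (f k)) := by
    rw [dt_sum]
    simp only [Pr_dt, ← hf]
    rw [Pr_sgl, eζ, map_add, hζ0 _ (by omega), zero_add]
    funext l
    rw [Finset.sum_apply]
    simp only [Pr_sgl]
    cases l with
    | nil => simp [sgl, Finset.smul_sum]
    | cons a l => simp [sgl]
  apply unit_inj M i (q • z) (by intro l hl; simp [hz l hl])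
    (q • Pr M i h + ∑ k, Pr M i (f k))
  rw [dt_add, dt_zsmul, ← eq2, ← smul_add, ← eq1]
  funext l; simp [smul_smul]

/-- transport along a group homomorphism -/
lemma sgl_inflate {A : Type} [Group A] {L : Type} [AddCommGroup L] (M : DGM G K) (Q : DGM A L)
    (φ : G →* A) (E : L →+ K) (hE : ∀ g x, E (Q.ρ (φ g) x) = M.ρ g (E x))
    (hED : ∀ x, E (Q.D x) = M.D (E x)) (k : L)
    (h : ∃ f, (sgl k : List A → L) = dt Q.ρ Q.D f) :
    ∃ f, (sgl (E k) : List G → K) = dt M.ρ M.D f := by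
  obtain ⟨f, hf⟩ := h
  refine ⟨fun l => E (f (l.map φ)), ?_⟩
  funext l
  have h1 := congrArg E (congrFun hf (l.map φ))
  have h2 : E (sgl k (l.map φ)) = sgl (E k) l := by cases l <;> simp [sgl]
  have h3 : bd (fun l : List G => E (f (l.map φ))) l = E (bd f (l.map φ)) := by
    rw [bd_comap φ (fun t => E (f t)), bd_map]
  have h4 : ad M.ρ (fun l : List G => E (f (l.map φ))) l = E (ad Q.ρ f (l.map φ)) := by
    cases l <;> simp [ad, hE]
  rw [← h2, h1]
  simp [dt, dG, tw, h3, h4, hED]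

end ev
end CE


namespace CE
open MvPolynomial

section odd
set_option linter.unusedSectionVars false
variable {X : Type} [Fintype X] [LinearOrder X] {V : Type} [AddCommGroup V]

/-- Koszul sign -/
def sgn (x : X) (O : Finset X) : ℤ := ∏ y ∈ O, if y < x then -1 else 1

/-- toggle membership -/
def tog (x : X) (O : Finset X) : Finset X := if x ∈ O then O.erase x else insert x O

lemma mem_tog (x y : X) (O : Finset X) : y ∈ tog x O ↔ (y ≠ x ∧ y ∈ O) ∨ (y = x ∧ x ∉ O) := by
  unfold tog; split_ifs with h
  · simp only [Finset.mem_erase]; tauto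
  · simp only [Finset.mem_insert]
    by_cases e : y = x
    · subst e; tauto
    · tauto

lemma tog_tog (x : X) (O : Finset X) : tog x (tog x O) = O := by
  ext y; simp only [mem_tog]
  by_cases e : y = x
  · subst e; tauto
  · tauto

lemma tog_comm (x y : X) (O : Finset X) : tog x (tog y O) = tog y (tog x O) := by
  ext z; simp only [mem_tog]
  by_cases e : z = x <;> by_cases e' : z = y
  · subst e; subst e'; rfl
  · subst e; simp [e', Ne.symm e']
  · subst e'; simp [e, Ne.symm e]
  · tauto

lemma sgn_insert (x y : X) (O : Finset X) (h : y ∉ O) :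
    sgn x (insert y O) = (if y < x then -1 else 1) * sgn x O := by
  simp [sgn, Finset.prod_insert h]

lemma sgn_tog (x y : X) (O : Finset X) :
    sgn x (tog y O) = (if y < x then -1 else 1) * sgn x O := by
  unfold tog; split_ifs with h h' h'
  · conv_rhs => rw [← Finset.insert_erase h, sgn_insert _ _ _ (Finset.notMem_erase y O)]
    simp [h']
  · conv_rhs => rw [← Finset.insert_erase h, sgn_insert _ _ _ (Finset.notMem_erase y O)]
    simp [h']
  · rw [sgn_insert _ _ _ h]; simp [h']
  · rw [sgn_insert _ _ _ h]; simp [h']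

lemma sgn_sq (x : X) (O : Finset X) : sgn x O * sgn x O = 1 := by
  rw [sgn, ← Finset.prod_mul_distrib]
  refine Finset.prod_eq_one fun y _ => ?_
  split_ifs <;> simp

/-- odd operator at x -/
def Odd (x : X) (A B : AddMonoid.End V) : AddMonoid.End (Finset X → V) where
  toFun f O := sgn x O • (if x ∈ O then A else B) (f (tog x O))
  map_zero' := by funext O; simp
  map_add' f g := by funext O; simp

lemma Odd_apply (x : X) (A B : AddMonoid.End V) (f : Finset X → V) (O : Finset X) :
    Odd x A B f O = sgn x O • (if x ∈ O then A else B) (f (tog x O)) := rfl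

lemma Odd_anti (x y : X) (hxy : x ≠ y) (A B A' B' : AddMonoid.End V)
    (h1 : ∀ v, A (A' v) = A' (A v)) (h2 : ∀ v, A (B' v) = B' (A v))
    (h3 : ∀ v, B (A' v) = A' (B v)) (h4 : ∀ v, B (B' v) = B' (B v)) (f : Finset X → V) :
    Odd x A B (Odd y A' B' f) = - Odd y A' B' (Odd x A B f) := by
  funext O
  have m1 : y ∈ tog x O ↔ y ∈ O := by rw [mem_tog]; tauto
  have m2 : x ∈ tog y O ↔ x ∈ O := by rw [mem_tog]; tauto
  simp only [Odd_apply, Pi.neg_apply, map_zsmul, m1, m2, sgn_tog, smul_smul, tog_comm x y]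
  have hc : (if x ∈ O then A else B) ((if y ∈ O then A' else B') (f (tog y (tog x O)))) =
      (if y ∈ O then A' else B') ((if x ∈ O then A else B) (f (tog y (tog x O)))) := by
    split_ifs <;> simp [h1, h2, h3, h4]
  rw [hc, ← neg_smul]
  congr 1
  rcases lt_or_gt_of_ne hxy with h | h
  · simp [h, h.not_gt]; ring
  · simp [h, h.not_gt]; ring

lemma Odd_comp (x : X) (A B A' B' : AddMonoid.End V) (f : Finset X → V) (O : Finset X) :
    Odd x A B (Odd x A' B' f) O = if x ∈ O then A (B' (f O)) else B (A' (f O)) := by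
  have m1 : x ∈ tog x O ↔ x ∉ O := by rw [mem_tog]; tauto
  simp only [Odd_apply, map_zsmul, m1, sgn_tog, smul_smul, tog_tog]
  simp only [lt_irrefl, if_false, one_mul, sgn_sq, one_smul]
  split_ifs <;> simp_all

end odd

section lop
set_option linter.unusedSectionVars false
variable {p : ℕ} [NeZero p] {X : Type} [Fintype X] [LinearOrder X] {R : Type} [AddCommGroup R]

/-- local operator at x -/
def Lop (x : X) (κ : Matrix (ZMod p) (ZMod p) ℤ) (Q : AddMonoid.End R) :
    AddMonoid.End ((X → ZMod p) → R) where
  toFun f i := ∑ j, κ (i x) j • Q (f (Function.update i x j))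
  map_zero' := by funext i; simp
  map_add' f g := by funext i; simp [Finset.sum_add_distrib]

lemma Lop_apply (x : X) (κ : Matrix (ZMod p) (ZMod p) ℤ) (Q : AddMonoid.End R)
    (f : (X → ZMod p) → R) (i : X → ZMod p) :
    Lop x κ Q f i = ∑ j, κ (i x) j • Q (f (Function.update i x j)) := rfl

lemma Lop_comm (x y : X) (hxy : x ≠ y) (κ κ' : Matrix (ZMod p) (ZMod p) ℤ) (Q Q' : AddMonoid.End R)
    (hQ : ∀ r, Q (Q' r) = Q' (Q r)) (f : (X → ZMod p) → R) :
    Lop x κ Q (Lop y κ' Q' f) = Lop y κ' Q' (Lop x κ Q f) := by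
  funext i
  simp only [Lop_apply, map_sum, map_zsmul, Finset.smul_sum]
  rw [Finset.sum_comm]
  refine Finset.sum_congr rfl fun j _ => Finset.sum_congr rfl fun k _ => ?_
  rw [Function.update_of_ne hxy.symm, Function.update_of_ne hxy, Function.update_comm hxy.symm,
    smul_comm, hQ]

lemma Lop_mul (x : X) (κ κ' : Matrix (ZMod p) (ZMod p) ℤ) (Q Q' : AddMonoid.End R)
    (f : (X → ZMod p) → R) :
    Lop x κ Q (Lop x κ' Q' f) = Lop x (κ * κ') (Q * Q') f := by
  funext i
  simp only [Lop_apply, map_sum, map_zsmul, Finset.smul_sum, Matrix.mul_apply, Finset.sum_smul]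
  rw [Finset.sum_comm]
  refine Finset.sum_congr rfl fun j _ => Finset.sum_congr rfl fun k _ => ?_
  simp [smul_smul]

lemma Lop_add (x : X) (κ κ' : Matrix (ZMod p) (ZMod p) ℤ) (Q : AddMonoid.End R)
    (f : (X → ZMod p) → R) : Lop x (κ + κ') Q f = Lop x κ Q f + Lop x κ' Q f := by
  funext i; simp [Lop_apply, add_smul, Finset.sum_add_distrib]

lemma Lop_add' (x : X) (κ : Matrix (ZMod p) (ZMod p) ℤ) (Q Q' : AddMonoid.End R)
    (f : (X → ZMod p) → R) : Lop x κ (Q + Q') f = Lop x κ Q f + Lop x κ Q' f := by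
  funext i
  have : ∀ r, (Q + Q') r = Q r + Q' r := fun r => rfl
  simp [Lop_apply, smul_add, Finset.sum_add_distrib, this]

lemma Lop_zero (x : X) (Q : AddMonoid.End R)
    (f : (X → ZMod p) → R) : Lop x (0 : Matrix (ZMod p) (ZMod p) ℤ) Q f = 0 := by
  funext i; simp [Lop_apply]

lemma Lop_one (x : X) (f : (X → ZMod p) → R) :
    Lop x (1 : Matrix (ZMod p) (ZMod p) ℤ) 1 f = f := by
  funext i; simp [Lop_apply, Matrix.one_apply]

/-- T - 1 -/
def kT : Matrix (ZMod p) (ZMod p) ℤ := fun a j => (if j = a + 1 then 1 else 0) - if j = a then 1 else 0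
/-- norm -/
def kN : Matrix (ZMod p) (ZMod p) ℤ := fun _ _ => 1
def kα : Matrix (ZMod p) (ZMod p) ℤ := fun a j => if j.val < a.val then 1 else 0
def kβ : Matrix (ZMod p) (ZMod p) ℤ := fun a j => if a + 1 = 0 ∧ j = 0 then 1 else 0
def k0 : Matrix (ZMod p) (ZMod p) ℤ := fun _ j => if j = 0 then 1 else 0

lemma kT_kN : (kT * kN : Matrix (ZMod p) (ZMod p) ℤ) = 0 := by
  ext a j; simp [Matrix.mul_apply, kT, kN]

lemma kN_kT : (kN * kT : Matrix (ZMod p) (ZMod p) ℤ) = 0 := by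
  ext a j; simp only [Matrix.mul_apply, kT, kN, one_mul, Finset.sum_sub_distrib]
  have : ∀ x : ZMod p, (j = x + 1) ↔ (x = j - 1) := fun x =>
    ⟨fun h => by rw [h]; ring, fun h => by rw [h]; ring⟩
  simp [this]

lemma val_succ (a : ZMod p) (h : a + 1 ≠ 0) : (a + 1).val = a.val + 1 := by
  have e : a + 1 = ((a.val + 1 : ℕ) : ZMod p) := by push_cast; rw [ZMod.natCast_zmod_val]
  have hlt : a.val + 1 < p := by
    have h1 := ZMod.val_lt a
    by_contra hc
    have h2 : a.val + 1 = p := by omega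
    rw [h2, ZMod.natCast_self] at e
    exact h e
  conv_lhs => rw [e]
  exact ZMod.val_natCast_of_lt hlt

lemma val_last (a : ZMod p) (h : a + 1 = 0) : a.val + 1 = p := by
  obtain ⟨n, rfl⟩ : ∃ n, p = n + 1 := ⟨p - 1, by have := NeZero.ne p; omega⟩
  have : a = -1 := eq_neg_of_add_eq_zero_left h
  rw [this, ZMod.val_neg_one]

lemma kid1 : (kT * kα + kβ * kN : Matrix (ZMod p) (ZMod p) ℤ) = 1 := by
  ext a j
  have e1 : (kT * kα : Matrix (ZMod p) (ZMod p) ℤ) a j = kα (a + 1) j - kα a j := by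
    simp [Matrix.mul_apply, kT, sub_mul, Finset.sum_sub_distrib]
  have e2 : (kβ * kN : Matrix (ZMod p) (ZMod p) ℤ) a j = if a + 1 = 0 then 1 else 0 := by
    simp only [Matrix.mul_apply, kβ, kN, mul_one]
    by_cases h : a + 1 = 0 <;> simp [h]
  rw [Matrix.add_apply, e1, e2, Matrix.one_apply]
  simp only [kα]
  have hj := ZMod.val_lt j
  have hinj : a = j ↔ a.val = j.val := (ZMod.val_injective p).eq_iff.symm
  by_cases h : a + 1 = 0
  · have := val_last a h
    simp only [h, ZMod.val_zero, hinj, if_true]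
    split_ifs <;> omega
  · rw [val_succ a h]
    simp only [h, hinj, if_false]
    split_ifs <;> omega

lemma kid2 : (kN * kβ : Matrix (ZMod p) (ZMod p) ℤ) = k0 := by
  ext a j
  simp only [Matrix.mul_apply, kβ, kN, k0, one_mul]
  by_cases h : j = 0
  · have : ∀ x : ZMod p, x + 1 = 0 ↔ x = -1 := fun x => eq_neg_iff_add_eq_zero.symm
    simp [h, this]
  · simp [h]

lemma kid3 : (kα * kT : Matrix (ZMod p) (ZMod p) ℤ) + k0 = 1 := by
  ext a j
  have h0 : ∀ x : ZMod p, (j = x + 1) ↔ (x = j - 1) := fun x =>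
    ⟨fun h => by rw [h]; ring, fun h => by rw [h]; ring⟩
  have e1 : (kα * kT : Matrix (ZMod p) (ZMod p) ℤ) a j = kα a (j - 1) - kα a j := by
    simp [Matrix.mul_apply, kT, mul_sub, Finset.sum_sub_distrib, h0]
  rw [Matrix.add_apply, e1, Matrix.one_apply]
  simp only [kα, k0]
  have ha := ZMod.val_lt a
  have hinj : a = j ↔ a.val = j.val := (ZMod.val_injective p).eq_iff.symm
  have hinj0 : j = 0 ↔ j.val = 0 := by rw [ZMod.val_eq_zero]
  by_cases h : j = 0
  · subst h
    have := val_last (0 - 1 : ZMod p) (by ring)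
    simp only [hinj, ZMod.val_zero, if_true]
    split_ifs <;> omega
  · have := val_succ (j - 1) (by simpa using h)
    rw [sub_add_cancel] at this
    simp only [h, hinj, if_false, this]
    split_ifs <;> omega

end lop
end CE


namespace CE
open MvPolynomial

section kx
set_option linter.unusedSectionVars false
variable {p : ℕ} [NeZero p] {X : Type} [Fintype X] [LinearOrder X]

/-- the coefficient ring -/
abbrev Po (X : Type) := MvPolynomial X ℤ
/-- the underlying module -/
abbrev KX (p : ℕ) (X : Type) := Finset X → (X → ZMod p) → Po X

noncomputable def mulX (x : X) : AddMonoid.End (Po X) := AddMonoidHom.mulLeft (MvPolynomial.X x)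
noncomputable def divX (x : X) : AddMonoid.End (Po X) where
  toFun P := MvPolynomial.divMonomial P (Finsupp.single x 1)
  map_zero' := zero_divMonomial _
  map_add' a b := add_divMonomial a b _
noncomputable def modX (x : X) : AddMonoid.End (Po X) := 1 - mulX x * divX x

lemma mulX_apply (x : X) (P : Po X) : mulX x P = MvPolynomial.X x * P := rfl
lemma coeff_mulX (x : X) (P : Po X) (m : X →₀ ℕ) :
    coeff m (mulX x P) = if m x = 0 then 0 else coeff (m - Finsupp.single x 1) P := by
  rw [mulX_apply, coeff_X_mul']
  simp only [Finsupp.mem_support_iff]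
  split_ifs <;> simp_all
lemma coeff_divX (x : X) (P : Po X) (m : X →₀ ℕ) :
    coeff m (divX x P) = coeff (Finsupp.single x 1 + m) P := by
  exact coeff_divMonomial _ _ _
lemma divX_mulX (x : X) : (divX x * mulX x : AddMonoid.End (Po X)) = 1 := by
  ext P : 1
  exact X_mul_divMonomial x P
lemma coeff_modX (x : X) (P : Po X) (m : X →₀ ℕ) :
    coeff m (modX x P) = if m x = 0 then coeff m P else 0 := by
  have : modX x P = P - mulX x (divX x P) := rfl
  rw [this, coeff_sub, coeff_mulX, coeff_divX]
  split_ifs with h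
  · simp
  · rw [sub_eq_zero]
    congr 1
    ext y
    simp only [Finsupp.add_apply, Finsupp.tsub_apply, Finsupp.single_apply]
    split_ifs with e
    · subst e; omega
    · omega

lemma mulX_comm (x y : X) (P : Po X) : mulX x (mulX y P) = mulX y (mulX x P) := by
  simp only [mulX_apply]; ring

lemma divX_mulX_comm (x y : X) (h : x ≠ y) (P : Po X) :
    divX x (mulX y P) = mulX y (divX x P) := by
  ext m
  rw [coeff_divX, coeff_mulX, coeff_mulX, coeff_divX]
  simp only [Finsupp.add_apply, Finsupp.single_apply, if_neg h, zero_add]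
  split_ifs with e
  · rfl
  · congr 1
    ext z
    simp only [Finsupp.add_apply, Finsupp.tsub_apply, Finsupp.single_apply]
    split_ifs with e1 e2 e2
    · exact absurd (e1.trans e2.symm) h
    · omega
    · omega
    · omega

noncomputable def Dx (x : X) : AddMonoid.End (KX p X) :=
  Odd x (Lop x kT 1) (Lop x kN (mulX x))
noncomputable def Sx (x : X) : AddMonoid.End (KX p X) :=
  Odd x (Lop x kβ (divX x)) (Lop x kα 1)
noncomputable def πx (x : X) : AddMonoid.End (KX p X) where
  toFun f O := if x ∈ O then 0 else Lop x k0 (modX x) (f O)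
  map_zero' := by funext O; simp
  map_add' f g := by funext O; split_ifs <;> simp_all

noncomputable def DX : AddMonoid.End (KX p X) where
  toFun f := ∑ x : X, Dx x f
  map_zero' := by simp
  map_add' f g := by simp [Finset.sum_add_distrib]

lemma DX_apply (f : KX p X) : DX f = ∑ x : X, Dx x f := by
  rfl

lemma Dx_anti (x y : X) (h : x ≠ y) (f : KX p X) : Dx x (Dx y f) = - Dx y (Dx x f) := by
  apply Odd_anti x y h <;> intro v <;> apply Lop_comm x y h
  · intro r; rfl
  · intro r; rfl
  · intro r; rfl
  · exact mulX_comm x y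

lemma Sx_anti (x y : X) (h : x ≠ y) (f : KX p X) : Sx x (Dx y f) = - Dx y (Sx x f) := by
  apply Odd_anti x y h <;> intro v <;> apply Lop_comm x y h
  · intro r; rfl
  · exact divX_mulX_comm x y h
  · intro r; rfl
  · intro r; rfl

lemma Dx_Dx (x : X) (f : KX p X) : Dx x (Dx x f) = 0 := by
  funext O
  simp only [Dx, Odd_comp, Lop_mul, kT_kN, kN_kT, Lop_zero]
  simp

lemma DX_DX (f : KX p X) : DX (DX f) = 0 := by
  have h : DX (DX f) = ∑ x : X, ∑ y : X, Dx x (Dx y f) := by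
    rw [DX_apply]
    refine Finset.sum_congr rfl fun x _ => ?_
    rw [DX_apply, map_sum]
  have h2 : DX (DX f) = - DX (DX f) := by
    conv_lhs => rw [h, Finset.sum_comm]
    rw [h]
    simp only [← Finset.sum_neg_distrib]
    refine Finset.sum_congr rfl fun x _ => Finset.sum_congr rfl fun y _ => ?_
    by_cases e : x = y
    · subst e; simp [Dx_Dx]
    · rw [Dx_anti x y e]; simp
  funext O i
  have := congrFun (congrFun h2 O) i
  exact self_eq_neg.mp this

lemma htpy_x (x : X) (f : KX p X) : Dx x (Sx x f) + Sx x (Dx x f) = f - πx x f := by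
  funext O
  simp only [Dx, Sx, Pi.add_apply, Odd_comp, Lop_mul, Pi.sub_apply]
  have hπ : πx x f O = if x ∈ O then 0 else Lop x k0 (modX x) (f O) := rfl
  rw [hπ]
  split_ifs with h
  · simp only [divX_mulX, one_mul]
    rw [← Lop_add, kid1, Lop_one]; simp
  · have e : Lop x (k0 : Matrix (ZMod p) (ZMod p) ℤ) (mulX x * divX x) (f O) +
        Lop x (k0 : Matrix (ZMod p) (ZMod p) ℤ) (modX x) (f O) =
        Lop x (k0 : Matrix (ZMod p) (ZMod p) ℤ) 1 (f O) := by
      rw [← Lop_add']; simp [modX]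
    have e2 := Lop_add x (kα * kT : Matrix (ZMod p) (ZMod p) ℤ) k0 1 (f O)
    rw [kid3, Lop_one] at e2
    rw [kid2]
    simp only [one_mul, mul_one]
    rw [eq_sub_iff_add_eq, add_right_comm, e, add_comm, ← e2]

lemma htpy (x : X) (f : KX p X) : DX (Sx x f) + Sx x (DX f) = f - πx x f := by
  rw [← htpy_x, DX_apply, DX_apply, map_sum, ← Finset.sum_add_distrib]
  rw [← Finset.add_sum_erase _ _ (Finset.mem_univ x)]
  rw [Finset.sum_eq_zero, add_zero]
  intro y hy
  rw [Sx_anti x y (Finset.ne_of_mem_erase hy).symm]; simp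

/-- homogeneous filter -/
noncomputable def fil (n a : ℕ) : AddMonoid.End (Po X) :=
  { toFun := fun P => if a ≤ n ∧ 2 ∣ (n - a) then homogeneousComponent ((n - a) / 2) P else 0
    map_zero' := by simp
    map_add' := by intro P Q; split_ifs <;> simp }

lemma fil_apply (n a : ℕ) (P : Po X) : fil n a P =
  if a ≤ n ∧ 2 ∣ (n - a) then homogeneousComponent ((n - a) / 2) P else 0 := rfl

lemma coeff_fil (n a : ℕ) (P : Po X) (m : X →₀ ℕ) :
    coeff m (fil n a P) = if a + 2 * m.degree = n then coeff m P else 0 := by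
  rw [fil_apply]
  by_cases h : a ≤ n ∧ 2 ∣ (n - a)
  · rw [if_pos h, coeff_homogeneousComponent]
    have : m.degree = (n - a) / 2 ↔ a + 2 * m.degree = n := by omega
    simp [this]
  · rw [if_neg h, if_neg (by intro hc; apply h; omega)]
    rfl

/-- degree projections -/
noncomputable def prX (n : ℕ) : AddMonoid.End (KX p X) where
  toFun f O i := fil n O.card (f O i)
  map_zero' := by funext O i; simp
  map_add' f g := by funext O i; simp

lemma prX_apply (n : ℕ) (f : KX p X) (O : Finset X) (i : X → ZMod p) :
    prX n f O i = fil n O.card (f O i) := rfl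

lemma coeff_prX (n : ℕ) (f : KX p X) (O : Finset X) (i : X → ZMod p) (m : X →₀ ℕ) :
    coeff m (prX n f O i) = if O.card + 2 * m.degree = n then coeff m (f O i) else 0 := by
  rw [prX_apply, coeff_fil]

lemma prX_prX (m n : ℕ) (f : KX p X) : prX m (prX n f) = if m = n then prX n f else 0 := by
  funext O i
  ext d
  rw [coeff_prX]
  split_ifs with h1 h2 h2
  · rfl
  · rw [coeff_prX, if_neg (by omega)]; rfl
  · rw [coeff_prX, if_neg (by omega)]
  · rfl

lemma prX_ext (f : KX p X) (h : ∀ m, prX m f = 0) : f = 0 := by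
  funext O i
  ext d
  have := congrArg (coeff d) (congrFun (congrFun (h (O.card + 2 * d.degree)) O) i)
  rw [coeff_prX, if_pos rfl] at this
  exact this

lemma prX_bdd (f : KX p X) : ∃ N, ∀ m, N ≤ m → prX m f = 0 := by
  have h1 : ∃ N, ∀ O i, (f O i).totalDegree ≤ N := by
    refine ⟨Finset.univ.sup fun O => Finset.univ.sup fun i => (f O i).totalDegree, ?_⟩
    intro O i
    exact le_trans (Finset.le_sup (f := fun i => (f O i).totalDegree) (Finset.mem_univ i))
      (Finset.le_sup (f := fun O => Finset.univ.sup fun i => (f O i).totalDegree)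
        (Finset.mem_univ O))
  obtain ⟨N, hN⟩ := h1
  refine ⟨Fintype.card X + 2 * N + 1, ?_⟩
  intro m hm
  funext O i; ext d
  rw [coeff_prX]
  split_ifs with h
  · have h2 : O.card ≤ Fintype.card X := Finset.card_le_univ O
    have h3 : N < d.degree := by omega
    rw [coeff_eq_zero_of_totalDegree_lt]
    · rfl
    · have := lt_of_le_of_lt (hN O i) h3
      exact this
  · rfl

lemma Lop_fil (x : X) (κ : Matrix (ZMod p) (ZMod p) ℤ) (Q φ ψ : AddMonoid.End (Po X))
    (h : ∀ P, φ (Q P) = Q (ψ P)) (f : (X → ZMod p) → Po X) (i : X → ZMod p) :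
    φ (Lop x κ Q f i) = Lop x κ Q (fun i => ψ (f i)) i := by
  simp only [Lop_apply, map_sum, map_zsmul, h]

lemma card_tog_mem (x : X) (O : Finset X) (h : x ∈ O) : (tog x O).card + 1 = O.card := by
  simp only [tog, h, if_true]
  exact Finset.card_erase_add_one h
lemma card_tog_notMem (x : X) (O : Finset X) (h : x ∉ O) : (tog x O).card = O.card + 1 := by
  simp only [tog, h, if_false]
  exact Finset.card_insert_of_notMem h

lemma degree_single_add (x : X) (m : X →₀ ℕ) :
    (Finsupp.single x 1 + m).degree = m.degree + 1 := by
  simp [add_comm]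

lemma degree_sub_single (x : X) (m : X →₀ ℕ) (h : m x ≠ 0) :
    (m - Finsupp.single x 1).degree + 1 = m.degree := by
  rw [← degree_single_add x]
  congr 1
  ext y
  simp only [Finsupp.add_apply, Finsupp.tsub_apply, Finsupp.single_apply]
  split_ifs with e
  · subst e; omega
  · omega

lemma prX_Dx (n : ℕ) (x : X) (f : KX p X) : prX (n + 1) (Dx x f) = Dx x (prX n f) := by
  funext O i
  simp only [prX_apply, Dx, Odd_apply, Pi.smul_apply, map_zsmul]
  congr 1
  split_ifs with h
  · rw [Lop_fil x kT 1 _ (fil n (tog x O).card)]; rfl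
    intro P
    ext m
    have := card_tog_mem x O h
    change coeff m (fil (n + 1) O.card P) = coeff m (fil n (tog x O).card P)
    simp only [coeff_fil]
    congr 1
    simp; omega
  · rw [Lop_fil x kN (mulX x) _ (fil n (tog x O).card)]; rfl
    intro P
    ext m
    have := card_tog_notMem x O h
    simp only [coeff_fil, coeff_mulX]
    by_cases hm : m x = 0
    · simp [hm]
    · have h2 := degree_sub_single x m hm
      simp only [hm, if_false]
      congr 1
      simp; omega

lemma prX0_Dx (x : X) (f : KX p X) : prX 0 (Dx x f) = 0 := by
  funext O i
  simp only [prX_apply, Dx, Odd_apply, Pi.smul_apply, map_zsmul]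
  have : fil 0 O.card ((if x ∈ O then Lop x kT 1 else Lop x kN (mulX x)) (f (tog x O)) i) = 0 := by
    split_ifs with h
    · rw [Lop_fil x kT 1 _ 0]
      · simp [Lop_apply]
      intro P
      ext m
      have := card_tog_mem x O h
      change coeff m (fil 0 O.card P) = coeff m (0 : Po X)
      rw [coeff_fil, if_neg (by omega)]; rfl
    · rw [Lop_fil x kN (mulX x) _ 0]
      · simp [Lop_apply]
      intro P
      ext m
      change _ = coeff m (mulX x 0)
      rw [map_zero]
      simp only [coeff_fil, coeff_mulX]
      by_cases hm : m x = 0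
      · simp [hm]
      · have h2 := degree_sub_single x m hm
        rw [if_neg (by omega)]; rfl
  rw [this]; simp

lemma prX_Sx (n : ℕ) (x : X) (f : KX p X) : prX n (Sx x f) = Sx x (prX (n + 1) f) := by
  funext O i
  simp only [prX_apply, Sx, Odd_apply, Pi.smul_apply, map_zsmul]
  congr 1
  split_ifs with h
  · rw [Lop_fil x kβ (divX x) _ (fil (n + 1) (tog x O).card)]; rfl
    intro P
    ext m
    have := card_tog_mem x O h
    simp only [coeff_fil, coeff_divX, degree_single_add]
    congr 1
    simp; omega
  · rw [Lop_fil x kα 1 _ (fil (n + 1) (tog x O).card)]; rfl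
    intro P
    ext m
    have := card_tog_notMem x O h
    change coeff m (fil n O.card P) = coeff m (fil (n + 1) (tog x O).card P)
    simp only [coeff_fil]
    congr 1
    simp; omega

lemma coeff_πx (x : X) (f : KX p X) (O : Finset X) (i : X → ZMod p) (m : X →₀ ℕ) :
    coeff m (πx x f O i) =
      if x ∉ O ∧ m x = 0 then coeff m (f O (Function.update i x 0)) else 0 := by
  have hπ : πx x f O = if x ∈ O then 0 else Lop x k0 (modX x) (f O) := rfl
  rw [hπ]
  by_cases h : x ∈ O
  · simp [h]
  · have : Lop x k0 (modX x) (f O) i = modX x (f O (Function.update i x 0)) := by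
      simp [Lop_apply, k0]
    simp [h, this, coeff_modX]

lemma prX_πx (n : ℕ) (x : X) (f : KX p X) : prX n (πx x f) = πx x (prX n f) := by
  funext O i
  ext m
  simp only [coeff_prX, coeff_πx]
  split_ifs <;> rfl

lemma prX_DX (n : ℕ) (f : KX p X) : prX (n + 1) (DX f) = DX (prX n f) := by
  simp only [DX_apply, map_sum, prX_Dx]
lemma prX0_DX (f : KX p X) : prX 0 (DX f) = 0 := by
  simp only [DX_apply, map_sum, prX0_Dx, Finset.sum_const_zero]

/-- unit -/
noncomputable def ηX : KX p X := fun O _ => if O = ∅ then 1 else 0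

lemma coeff_ηX (c : ℤ) (O : Finset X) (i : X → ZMod p) (m : X →₀ ℕ) :
    coeff m ((c • (ηX : KX p X)) O i) = if O = ∅ ∧ m = 0 then c else 0 := by
  have : (c • (ηX : KX p X)) O i = c • (if O = ∅ then (1 : Po X) else 0) := rfl
  rw [this, coeff_smul]
  by_cases h : O = ∅
  · by_cases h' : m = 0
    · simp [h, h']
    · simp [h, h', coeff_one, Ne.symm h']
  · simp [h]

lemma contraction (s : Finset X) : ∃ S Pj : AddMonoid.End (KX p X),
    (∀ f, f = Pj f + DX (S f) + S (DX f)) ∧ (∀ n f, prX n (S f) = S (prX (n + 1) f)) ∧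
    (∀ n f, prX n (Pj f) = Pj (prX n f)) ∧
    ∀ f O i m, coeff m (Pj f O i) =
      if (∀ x ∈ s, x ∉ O ∧ m x = 0) then coeff m (f O (fun y => if y ∈ s then 0 else i y)) else 0 := by
  induction s using Finset.induction_on with
  | empty =>
    refine ⟨0, 1, ?_, ?_, ?_, ?_⟩
    · intro f
      change f = f + DX 0 + 0
      rw [map_zero, add_zero, add_zero]
    · intro n f
      change prX n 0 = 0
      rw [map_zero]
    · intro n f; rfl
    · intro f O i m
      change coeff m (f O i) = _
      rw [if_pos (by intro x hx; exact absurd hx (Finset.notMem_empty x))]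
      congr 2
  | insert x s hx ih =>
    obtain ⟨S, Pj, h1, h2, h3, h4⟩ := ih
    have hc : ∀ f, Pj (DX f) = DX (Pj f) := by
      intro f
      have a := h1 (DX f)
      have b := congrArg DX (h1 f)
      simp only [map_add, DX_DX, map_zero, add_zero] at a b
      have c : Pj (DX f) + DX (S (DX f)) = DX (Pj f) + DX (S (DX f)) := a.symm.trans b
      exact add_right_cancel (G := KX p X) c
    refine ⟨S + Pj * Sx x, Pj * πx x, ?_, ?_, ?_, ?_⟩
    · intro f
      have e := congrArg Pj (htpy x f)
      rw [map_add, map_sub, hc] at e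
      have e0 := h1 f
      change f = Pj (πx x f) + DX (S f + Pj (Sx x f)) + (S (DX f) + Pj (Sx x (DX f)))
      rw [map_add]
      have e1 : Pj f = Pj (πx x f) + (DX (Pj (Sx x f)) + Pj (Sx x (DX f))) := by rw [e]; abel
      rw [e1] at e0
      refine e0.trans ?_
      abel
    · intro n f
      change prX n (S f + Pj (Sx x f)) = S (prX (n+1) f) + Pj (Sx x (prX (n+1) f))
      rw [map_add, h2, h3, prX_Sx]
    · intro n f
      change prX n (Pj (πx x f)) = Pj (πx x (prX n f))
      rw [h3, prX_πx]
    · intro f O i m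
      change coeff m (Pj (πx x f) O i) = _
      rw [h4, coeff_πx]
      simp only [Finset.forall_mem_insert]
      have : Function.update (fun y => if y ∈ s then 0 else i y) x 0 =
          fun y => if y ∈ insert x s then (0 : ZMod p) else i y := by
        funext y
        by_cases e : y = x
        · subst e; simp
        · simp [Function.update_of_ne e, Finset.mem_insert, e]
      rw [this]
      by_cases a : ∀ x ∈ s, x ∉ O ∧ m x = 0 <;> by_cases b : x ∉ O ∧ m x = 0 <;> simp [a, b]

noncomputable def εX : KX p X →+ ℤ where
  toFun f := coeff 0 (f ∅ 0)
  map_zero' := by simp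
  map_add' f g := by simp

lemma contractionX : ∃ S : AddMonoid.End (KX p X),
    (∀ f, f = εX f • ηX + DX (S f) + S (DX f)) ∧ (∀ n f, prX n (S f) = S (prX (n + 1) f)) := by
  obtain ⟨S, Pj, h1, h2, -, h4⟩ := contraction (p := p) (Finset.univ : Finset X)
  refine ⟨S, ?_, h2⟩
  intro f
  have : Pj f = εX f • ηX := by
    funext O i
    ext m
    rw [h4]
    have e : (∀ x ∈ (Finset.univ : Finset X), x ∉ O ∧ m x = 0) ↔ O = ∅ ∧ m = 0 := by
      constructor
      · intro h
        exact ⟨Finset.eq_empty_of_forall_notMem fun x => (h x (Finset.mem_univ x)).1,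
          Finsupp.ext fun x => (h x (Finset.mem_univ x)).2⟩
      · rintro ⟨rfl, rfl⟩; simp
    simp only [e]
    by_cases hO : O = ∅
    · subst hO
      by_cases hm : m = 0
      · subst hm; rw [coeff_ηX, if_pos ⟨rfl, rfl⟩, if_pos ⟨rfl, rfl⟩]
        simp only [Finset.mem_univ, if_true]; rfl
      · rw [coeff_ηX, if_neg (by tauto), if_neg (by tauto)]
    · rw [coeff_ηX, if_neg (by tauto), if_neg (by tauto)]
  rw [← this]; exact h1 f

end kx
end CE


namespace CE
open MvPolynomial

section push
set_option linter.unusedSectionVars false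
variable {p : ℕ} [NeZero p] {W X Y : Type} [Fintype W] [LinearOrder W] [Fintype X] [LinearOrder X]
  [Fintype Y] [LinearOrder Y]

/-- inversion sign of a pair -/
def ivs (e : X ↪ Y) : Sym2 X → ℤ := Sym2.lift ⟨fun x y => if (x < y ↔ e x < e y) then 1 else -1, by
  intro x y
  rcases lt_trichotomy x y with h | h | h
  · have h1 : e x ≠ e y := e.injective.ne h.ne
    rcases lt_or_gt_of_ne h1 with h2 | h2 <;> simp [h, h2, h.not_gt, h2.not_gt]
  · subst h; rfl
  · have h1 : e x ≠ e y := e.injective.ne h.ne'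
    rcases lt_or_gt_of_ne h1 with h2 | h2 <;> simp [h, h2, h.not_gt, h2.not_gt]⟩

lemma ivs_mk (e : X ↪ Y) (x y : X) : ivs e s(x, y) = if (x < y ↔ e x < e y) then 1 else -1 := rfl

/-- reordering sign -/
def sg (e : X ↪ Y) (O : Finset X) : ℤ := ∏ z ∈ O.sym2, ivs e z

lemma sg_trans (e : W ↪ X) (e' : X ↪ Y) (O : Finset W) :
    sg (e.trans e') O = sg e' (O.map e) * sg e O := by
  rw [sg, sg, sg, Finset.sym2_map, Finset.prod_map, ← Finset.prod_mul_distrib]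
  refine Finset.prod_congr rfl fun z _ => ?_
  induction z using Sym2.ind with
  | _ x y =>
    change ivs (e.trans e') s(x, y) = ivs e' s(e x, e y) * ivs e s(x, y)
    simp only [ivs_mk, Function.Embedding.trans_apply]
    by_cases a : x < y <;> by_cases b : e x < e y <;> by_cases c : e' (e x) < e' (e y) <;>
      simp [a, b, c]

lemma sg_refl (O : Finset X) : sg (Function.Embedding.refl X) O = 1 := by
  refine Finset.prod_eq_one fun z _ => ?_
  induction z using Sym2.ind with
  | _ x y => simp [ivs_mk]

lemma sg_insert (e : X ↪ Y) (x : X) (O : Finset X) (h : x ∉ O) :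
    sg e (insert x O) = sgn x O * sgn (e x) (O.map e) * sg e O := by
  rw [← Finset.cons_eq_insert _ _ h, sg, Finset.sym2_cons, Finset.prod_disjUnion, Finset.prod_map,
    Finset.prod_cons]
  have h1 : ivs e (Sym2.mkEmbedding x x) = 1 := by
    change ivs e s(x, x) = 1
    simp [ivs_mk]
  rw [h1, one_mul, sgn, sgn, Finset.prod_map, ← Finset.prod_mul_distrib, sg]
  congr 1
  refine Finset.prod_congr rfl fun y hy => ?_
  change ivs e s(x, y) = _
  have hne : x ≠ y := fun c => h (c ▸ hy)
  have h1 : e x ≠ e y := e.injective.ne hne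
  rw [ivs_mk]
  rcases lt_or_gt_of_ne hne with h2 | h2 <;> rcases lt_or_gt_of_ne h1 with h3 | h3 <;>
    simp [h2, h3, h2.not_gt, h3.not_gt]

lemma sg_tog (e : X ↪ Y) (x : X) (O : Finset X) :
    sg e (tog x O) = sgn x O * sgn (e x) (O.map e) * sg e O := by
  by_cases h : x ∈ O
  · have hO : O = insert x (O.erase x) := (Finset.insert_erase h).symm
    have hn := Finset.notMem_erase x O
    have e1 := sg_insert e x _ hn
    rw [← hO] at e1
    have e2 : tog x O = O.erase x := by simp [tog, h]
    have e3 : sgn x O = sgn x (O.erase x) := by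
      rw [← e2, sgn_tog]; simp
    have e4 : sgn (e x) (O.map e) = sgn (e x) ((O.erase x).map e) := by
      simp only [sgn, Finset.prod_map]
      rw [← Finset.mul_prod_erase _ _ h]; simp
    have s1 := sgn_sq x (O.erase x)
    have s2 := sgn_sq (e x) ((O.erase x).map e)
    rw [e1, e2, e3, e4]
    linear_combination (-(sgn (e x) ((O.erase x).map e) * sgn (e x) ((O.erase x).map e)) * s1 - s2) * sg e (O.erase x)
  · have e2 : tog x O = insert x O := by simp [tog, h]
    rw [e2, sg_insert e x O h]

lemma map_tog (e : X ↪ Y) (x : X) (O : Finset X) : (tog x O).map e = tog (e x) (O.map e) := by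
  ext y
  simp only [Finset.mem_map, mem_tog]
  constructor
  · rintro ⟨z, h, rfl⟩
    rcases h with ⟨h1, h2⟩ | ⟨rfl, h2⟩
    · left; exact ⟨e.injective.ne h1, z, h2, rfl⟩
    · right; refine ⟨rfl, ?_⟩
      rintro ⟨w, hw, hw'⟩; exact h2 (e.injective hw' ▸ hw)
  · rintro (⟨h1, z, h2, rfl⟩ | ⟨rfl, h2⟩)
    · exact ⟨z, Or.inl ⟨fun c => h1 (c ▸ rfl), h2⟩, rfl⟩
    · exact ⟨x, Or.inr ⟨rfl, fun c => h2 ⟨x, c, rfl⟩⟩, rfl⟩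

/-- preimage -/
def pre (e : X ↪ Y) (O : Finset Y) : Finset X := Finset.univ.filter fun x => e x ∈ O

lemma pre_map (e : X ↪ Y) (O : Finset X) : pre e (O.map e) = O := by
  ext x; simp [pre]

lemma map_pre (e : X ↪ Y) (O : Finset Y) (h : ∀ y ∈ O, y ∈ Set.range e) : (pre e O).map e = O := by
  ext y
  simp only [pre, Finset.mem_map, Finset.mem_filter, Finset.mem_univ, true_and]
  constructor
  · rintro ⟨x, hx, rfl⟩; exact hx
  · intro hy; obtain ⟨x, rfl⟩ := h y hy; exact ⟨x, hy, rfl⟩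

open Classical in
/-- push forward along an embedding with a shift -/
noncomputable def T (e : X ↪ Y) (s : X → ZMod p) : KX p X →+ KX p Y where
  toFun f O i := if (∀ y ∈ O, y ∈ Set.range e) then
    sg e (pre e O) • rename e (f (pre e O) (fun x => i (e x) - s x)) else 0
  map_zero' := by funext O i; simp
  map_add' f g := by funext O i; simp only [Pi.add_apply]; split_ifs <;> simp

lemma T_map (e : X ↪ Y) (s : X → ZMod p) (f : KX p X) (O : Finset X) (i : Y → ZMod p) :
    T e s f (O.map e) i = sg e O • rename e (f O (fun x => i (e x) - s x)) := by
  have : T e s f (O.map e) i = if (∀ y ∈ O.map e, y ∈ Set.range e) then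
    sg e (pre e (O.map e)) • rename e (f (pre e (O.map e)) (fun x => i (e x) - s x)) else 0 := rfl
  rw [this, if_pos, pre_map]
  intro y hy
  obtain ⟨x, -, rfl⟩ := Finset.mem_map.1 hy
  exact ⟨x, rfl⟩

lemma T_not (e : X ↪ Y) (s : X → ZMod p) (f : KX p X) (O : Finset Y) (i : Y → ZMod p)
    (h : ¬ ∀ y ∈ O, y ∈ Set.range e) : T e s f O i = 0 := if_neg h

lemma T_ext (e : X ↪ Y) (s : X → ZMod p) (f : KX p X) (g : KX p Y)
    (h1 : ∀ O i, sg e O • rename e (f O (fun x => i (e x) - s x)) = g (O.map e) i)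
    (h2 : ∀ O i, (¬ ∀ y ∈ O, y ∈ Set.range e) → g O i = 0) : T e s f = g := by
  funext O i
  by_cases h : ∀ y ∈ O, y ∈ Set.range e
  · rw [← map_pre e O h, T_map, h1]
  · rw [T_not _ _ _ _ _ h, h2 _ _ h]

lemma T_trans (e : W ↪ X) (e' : X ↪ Y) (s : W → ZMod p) (s' : X → ZMod p) (f : KX p W) :
    T e' s' (T e s f) = T (e.trans e') (fun w => s w + s' (e w)) f := by
  symm
  apply T_ext
  · intro O i
    rw [← Finset.map_map, T_map, T_map, sg_trans, map_zsmul, rename_rename, smul_smul]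
    congr 3
    funext w
    simp only [Function.Embedding.trans_apply]
    ring
  · intro O i h
    by_cases h' : ∀ y ∈ O, y ∈ Set.range e'
    · rw [← map_pre e' O h', T_map, T_not]
      · simp
      · intro hc
        apply h
        intro y hy
        obtain ⟨x, rfl⟩ := h' y hy
        obtain ⟨w, rfl⟩ := hc x (by simp [pre, hy])
        exact ⟨w, rfl⟩
    · exact T_not _ _ _ _ _ h'

lemma T_refl (f : KX p X) : T (Function.Embedding.refl X) (fun _ => (0 : ZMod p)) f = f := by
  apply T_ext
  · intro O i
    rw [sg_refl, Finset.map_refl]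
    simp only [one_smul, Function.Embedding.refl_apply, sub_zero]
    exact rename_id_apply _
  · intro O i h
    exact absurd (fun y _ => ⟨y, rfl⟩) h

lemma kT_shift (a j t : ZMod p) : kT (a + t) (j + t) = kT a j := by
  have : j + t = a + t + 1 ↔ j = a + 1 := by
    rw [add_right_comm, add_left_inj]
  simp [kT, this]

lemma T_Lop (e : X ↪ Y) (s : X → ZMod p) (κ : Matrix (ZMod p) (ZMod p) ℤ)
    (hκ : ∀ a j t, κ (a + t) (j + t) = κ a j) (Q : AddMonoid.End (Po X)) (Q' : AddMonoid.End (Po Y))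
    (hQ : ∀ P, Q' (rename e P) = rename e (Q P)) (x : X) (h : (X → ZMod p) → Po X)
    (i : Y → ZMod p) :
    Lop (e x) κ Q' (fun i => rename e (h (fun x => i (e x) - s x))) i =
      rename e (Lop x κ Q h (fun x => i (e x) - s x)) := by
  simp only [Lop_apply, map_sum, map_zsmul, hQ]
  rw [← Equiv.sum_comp (Equiv.addRight (s x))]
  refine Finset.sum_congr rfl fun j _ => ?_
  simp only [Equiv.coe_addRight]
  have : i (e x) = (i (e x) - s x) + s x := by ring
  conv_lhs => rw [this, hκ]
  congr 4
  funext z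
  by_cases hz : z = x
  · subst hz; simp
  · rw [Function.update_of_ne (e.injective.ne hz), Function.update_of_ne hz]

lemma T_Dx (e : X ↪ Y) (s : X → ZMod p) (x : X) (f : KX p X) :
    T e s (Dx x f) = Dx (e x) (T e s f) := by
  have hz : ∀ O, (T e s f) (O.map e) =
      sg e O • fun i => rename e (f O (fun x => i (e x) - s x)) := by
    intro O; funext i; rw [T_map]; rfl
  apply T_ext
  · intro O i
    simp only [Dx, Odd_apply, ← map_tog, hz, map_zsmul, Pi.smul_apply, smul_smul, Finset.mem_map']
    have hs : sg e O * sgn x O = sgn (e x) (O.map e) * sg e (tog x O) := by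
      rw [sg_tog]
      linear_combination (-(sgn x O) * sg e O) * sgn_sq (e x) (O.map e)
    rw [hs]
    congr 1
    split_ifs with h
    · rw [T_Lop e s kT kT_shift 1 1 (fun _ => rfl)]
    · rw [T_Lop e s kN (fun _ _ _ => rfl) (mulX x) (mulX (e x))]
      intro P
      simp [mulX_apply]
  · intro O i h
    have : T e s f (tog (e x) O) = 0 := by
      funext i
      apply T_not
      intro hc
      apply h
      intro y hy
      by_cases hyx : y = e x
      · exact ⟨x, hyx.symm⟩
      · exact hc y (by rw [mem_tog]; exact Or.inl ⟨hyx, hy⟩)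
    simp [Dx, Odd_apply, this]

lemma Dx_T (e : X ↪ Y) (s : X → ZMod p) (y : Y) (hy : y ∉ Set.range e) (f : KX p X) :
    Dx y (T e s f) = 0 := by
  funext O i
  simp only [Dx, Odd_apply]
  by_cases h : y ∈ O
  · have : Lop y kT 1 (T e s f (tog y O)) i = 0 := by
      have hu : ∀ j, T e s f (tog y O) (Function.update i y j) = T e s f (tog y O) i := by
        intro j
        by_cases h' : ∀ z ∈ tog y O, z ∈ Set.range e
        · rw [← map_pre e _ h', T_map, T_map]
          congr 3
          funext x
          rw [Function.update_of_ne]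
          rintro rfl; exact hy ⟨x, rfl⟩
        · rw [T_not _ _ _ _ _ h', T_not _ _ _ _ _ h']
      simp only [Lop_apply, hu]
      rw [← Finset.sum_smul]
      have : ∑ j, kT (i y) j = 0 := by simp [kT]
      rw [this, zero_smul]
    simp only [h, if_true, Pi.smul_apply, this, smul_zero]; rfl
  · have : T e s f (tog y O) = 0 := by
      funext i
      apply T_not
      intro hc
      exact hy (hc y (by rw [mem_tog]; exact Or.inr ⟨rfl, h⟩))
    rw [this]; simp

lemma T_DX (e : X ↪ Y) (s : X → ZMod p) (f : KX p X) : T e s (DX f) = DX (T e s f) := by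
  rw [DX_apply, DX_apply, map_sum]
  simp only [T_Dx]
  rw [← Finset.sum_map Finset.univ e (fun y => Dx y (T e s f))]
  apply Finset.sum_subset (Finset.subset_univ _)
  intro y _ hy
  apply Dx_T
  rintro ⟨x, rfl⟩; exact hy (by simp)

lemma T_prX (e : X ↪ Y) (s : X → ZMod p) (n : ℕ) (f : KX p X) :
    T e s (prX n f) = prX n (T e s f) := by
  apply T_ext
  · intro O i
    rw [prX_apply, prX_apply, T_map, map_zsmul, Finset.card_map]
    congr 1
    rw [fil_apply, fil_apply]
    split_ifs
    · exact rename_homogeneousComponent _ _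
    · simp
  · intro O i h
    rw [prX_apply, T_not _ _ _ _ _ h, map_zero]

/-- scalar multiplication by polynomials on the unit -/
noncomputable def mη (r : Po X) : KX p X := fun O _ => if O = ∅ then r else 0

lemma T_mη (e : X ↪ Y) (s : X → ZMod p) (r : Po X) :
    T e s (mη r) = mη (rename e r) := by
  apply T_ext
  · intro O i
    by_cases h : O = ∅
    · subst h; simp [mη, sg]
    · simp [mη, h]
  · intro O i h
    have : O ≠ ∅ := by rintro rfl; exact h (by simp)
    simp [mη, this]

end push
end CE


namespace CE
open MvPolynomial

section act
set_option linter.unusedSectionVars false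
variable {p : ℕ} [NeZero p] {X Y : Type} [Fintype X] [LinearOrder X] [Fintype Y] [LinearOrder Y]

lemma smul_ηX (r : Po X) : (r • ηX : KX p X) = mη r := by
  funext O i
  simp [mη, ηX]

lemma Lop_smul (x : X) (κ : Matrix (ZMod p) (ZMod p) ℤ) (Q : AddMonoid.End (Po X)) (r : Po X)
    (h : ∀ P, Q (r * P) = r * Q P) (f : (X → ZMod p) → Po X) :
    Lop x κ Q (r • f) = r • Lop x κ Q f := by
  funext i
  simp only [Lop_apply, Pi.smul_apply, smul_eq_mul, h, Finset.mul_sum, mul_smul_comm]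

lemma Dx_smul (x : X) (r : Po X) (f : KX p X) : Dx x (r • f) = r • Dx x f := by
  funext O
  simp only [Dx, Odd_apply, Pi.smul_apply]
  rw [smul_comm r]
  congr 1
  split_ifs with h
  · exact Lop_smul x kT 1 r (fun _ => rfl) _
  · exact Lop_smul x kN (mulX x) r (fun P => by simp only [mulX_apply]; ring) _

lemma DX_smul (r : Po X) (f : KX p X) : DX (r • f) = r • DX f := by
  simp only [DX_apply, Dx_smul, Finset.smul_sum]

lemma T_smul (e : X ↪ Y) (s : X → ZMod p) (r : Po X) (f : KX p X) :
    T e s (r • f) = rename e r • T e s f := by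
  apply T_ext
  · intro O i
    simp only [Pi.smul_apply, T_map, smul_eq_mul, map_mul, mul_smul_comm]
  · intro O i h
    simp only [Pi.smul_apply, T_not _ _ _ _ _ h, smul_zero]

lemma ηX_eq : (ηX : KX p X) = mη 1 := rfl

lemma T_ηX (e : X ↪ Y) (s : X → ZMod p) : T e s (ηX : KX p X) = ηX := by
  rw [ηX_eq, T_mη, map_one, ηX_eq]

lemma DX_ηX : DX (ηX : KX p X) = 0 := by
  have key : ∀ x : X, Dx x (ηX : KX p X) = 0 := by
    intro x
    funext O i
    simp only [Dx, Odd_apply]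
    by_cases h : x ∈ O
    · have : Lop x kT 1 (ηX (p := p) (tog x O)) i = 0 := by
        have hu : ∀ j, (ηX (p := p) (tog x O)) (Function.update i x j) = ηX (tog x O) i :=
          fun j => rfl
        simp only [Lop_apply, hu]
        rw [← Finset.sum_smul]
        have : ∑ j, kT (i x) j = 0 := by simp [kT]
        rw [this, zero_smul]
      simp only [h, if_true, Pi.smul_apply, this, smul_zero]; rfl
    · have : (ηX : KX p X) (tog x O) = 0 := by
        funext i
        have hn : tog x O ≠ ∅ := by
          intro hc
          have : x ∈ tog x O := by rw [mem_tog]; exact Or.inr ⟨rfl, h⟩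
          rw [hc] at this; simp at this
        simp [ηX, hn]
      rw [this]; simp
  simp [DX_apply, key]

lemma prX_hom (r : Po X) (d : ℕ) (h : r.IsHomogeneous d) (n : ℕ) :
    prX n (mη r : KX p X) = if n = 2 * d then mη r else 0 := by
  funext O i
  ext m
  rw [coeff_prX]
  by_cases hO : O = ∅
  · subst hO
    have e : (mη r : KX p X) ∅ i = r := by simp [mη]
    rw [e]
    by_cases hm : coeff m r = 0
    · rw [hm]; split_ifs <;> simp [e, hm]
    · have hd : m.degree = d := by
        have := h hm
        rw [← this, Finsupp.degree_eq_weight_one]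
        rfl
      have : ((∅ : Finset X).card + 2 * m.degree = n) ↔ n = 2 * d := by
        rw [hd, Finset.card_empty, zero_add, eq_comm]
      simp only [this]
      split_ifs <;> simp [e]
  · have e : (mη r : KX p X) O i = 0 := by simp [mη, hO]
    rw [e]; split_ifs <;> simp [e]

variable {G : Type} [Group G] [MulAction G X] (c : G → X → ZMod p)

/-- permutation embedding -/
def em (g : G) : X ↪ X := (MulAction.toPerm g).toEmbedding

lemma em_apply (g : G) (x : X) : em g x = g • x := rfl

lemma T_mul (hc : ∀ g h x, c (g * h) x = c h x + c g (h • x)) (g h : G) (f : KX p X) :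
    T (em (g * h)) (c (g * h)) f = T (em g) (c g) (T (em h) (c h) f) := by
  have h2 : (em (g * h) : X ↪ X) = (em h).trans (em g) :=
    DFunLike.ext _ _ fun x => mul_smul g h x
  have h1 : c (g * h) = fun x => c h x + c g (em h x) := by
    funext x; rw [hc]; rfl
  rw [h1, h2, T_trans]

lemma T_one (hc : ∀ g h x, c (g * h) x = c h x + c g (h • x)) (f : KX p X) :
    T (em (1 : G)) (c 1) f = f := by
  have h1 : c 1 = fun _ => 0 := by
    funext x
    have := hc 1 1 x
    simpa using this
  have h2 : (em (1 : G)) = Function.Embedding.refl X :=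
    DFunLike.ext _ _ fun x => one_smul G x
  rw [h1, h2, T_refl]

/-- twisted action -/
noncomputable def ρX (hc : ∀ g h x, c (g * h) x = c h x + c g (h • x)) : G →* AddMonoid.End (KX p X) where
  toFun g := T (em g) (c g)
  map_one' := AddMonoidHom.ext fun f => T_one c hc f
  map_mul' g h := AddMonoidHom.ext fun f => T_mul c hc g h f

lemma ρX_apply (hc : ∀ g h x, c (g * h) x = c h x + c g (h • x)) (g : G) (f : KX p X) :
    ρX c hc g f = T (em g) (c g) f := rfl

/-- the dg module -/
noncomputable def MX (hc : ∀ g h x, c (g * h) x = c h x + c g (h • x)) : DGM G (KX p X) where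
  ρ := ρX c hc
  D := DX
  DD := DX_DX
  Dρ g x := (T_DX _ _ x).symm
  pr := prX
  prρ n g x := (T_prX _ _ n x).symm
  prD := prX_DX
  prD0 := prX0_DX
  prpr := prX_prX
  pr_ext := prX_ext
  pr_bdd := prX_bdd
  η := ηX
  ρη g := T_ηX _ _
  Dη := DX_ηX
  prη := by rw [ηX_eq, prX_hom 1 0 (isHomogeneous_one X ℤ)]; simp
  prη' n := by rw [ηX_eq, prX_hom 1 0 (isHomogeneous_one X ℤ)]; simp
  ε := εX
  εη := by
    change coeff 0 ((ηX : KX p X) ∅ 0) = 1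
    simp [ηX]
  S := contractionX.choose
  prS := contractionX.choose_spec.2
  hS := contractionX.choose_spec.1

lemma free_rep {L : Type} [MulAction G L] (h : ∀ (g : G) (l : L), g • l = l → g = 1) :
    ∃ R : L → Prop, ∀ l, ∃ g : G, ∀ g' : G, R (g'⁻¹ • l) ↔ g' = g := by
  classical
  refine ⟨fun l => (Quotient.mk (MulAction.orbitRel G L) l).out = l, fun l => ?_⟩
  have h0 : MulAction.orbitRel G L (Quotient.mk (MulAction.orbitRel G L) l).out l :=
    Quotient.mk_out (s := MulAction.orbitRel G L) l
  obtain ⟨g, hg⟩ := h0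
  refine ⟨g⁻¹, fun g' => ?_⟩
  have hq : Quotient.mk (MulAction.orbitRel G L) (g'⁻¹ • l) = Quotient.mk (MulAction.orbitRel G L) l :=
    Quotient.sound (s := MulAction.orbitRel G L) ⟨g'⁻¹, rfl⟩
  simp only at hg
  beta_reduce
  rw [hq, ← hg]
  constructor
  · intro h1
    have h2 : (g' * g) • l = l := by rw [mul_smul, h1, smul_inv_smul]
    exact eq_inv_of_mul_eq_one_left (h _ _ h2)
  · rintro rfl; simp

lemma MX_free [Fintype G] (hc : ∀ g h x, c (g * h) x = c h x + c g (h • x))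
    (hf : ∀ g : G, g ≠ 1 → ∃ x, g • x = x ∧ c g x ≠ 0) : IsFree (MX c hc).ρ := by
  classical
  have c1 : ∀ x, c 1 x = 0 := by
    intro x
    have := hc 1 1 x
    simpa using this
  let act : MulAction G (X → ZMod p) :=
    { smul := fun g i y => i (g⁻¹ • y) - c g⁻¹ y
      one_smul := by
        intro i; funext y
        change i ((1:G)⁻¹ • y) - c (1:G)⁻¹ y = i y
        simp [c1]
      mul_smul := by
        intro g h i; funext y
        change i ((g * h)⁻¹ • y) - c (g * h)⁻¹ y = (i (h⁻¹ • (g⁻¹ • y)) - c h⁻¹ (g⁻¹ • y)) - c g⁻¹ y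
        rw [mul_inv_rev, mul_smul, hc]; ring }
  have sm : ∀ (g : G) (i : X → ZMod p), g • i = fun y => i (g⁻¹ • y) - c g⁻¹ y := fun _ _ => rfl
  obtain ⟨R, hR⟩ := free_rep (G := G) (L := X → ZMod p) (by
    intro g i h
    by_contra hg
    obtain ⟨x, hx, hcx⟩ := hf g⁻¹ (by simpa using hg)
    have := congrFun h x
    rw [sm] at this
    simp only [hx] at this
    exact hcx (by simpa using this))
  refine ⟨{ toFun := fun f O i => if R i then f O i else 0
            map_zero' := by funext O i; simp
            map_add' := by intro f g; funext O i; simp only [Pi.add_apply]; split_ifs <;> simp }, ?_⟩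
  intro f
  have key : ∀ (g : G) (f : KX p X) (O : Finset X) (i : X → ZMod p),
      (MX c hc).ρ g (fun O i => if R i then f O i else 0) O i =
        if R (g⁻¹ • i) then (MX c hc).ρ g f O i else 0 := by
    intro g f O i
    have hO : ∀ y ∈ O, y ∈ Set.range (em g : X ↪ X) :=
      fun y _ => ⟨g⁻¹ • y, by simp [em_apply]⟩
    change T _ _ _ O i = if R (g⁻¹ • i) then T _ _ _ O i else 0
    rw [← map_pre _ O hO, T_map, T_map]
    have : (fun x => i ((em g : X ↪ X) x) - c g x) = g⁻¹ • i := by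
      rw [sm, inv_inv]; rfl
    rw [this]
    split_ifs <;> simp
  funext O i
  have e : ∀ g : G, ((MX c hc).ρ g) (fun O i => if R i then ((MX c hc).ρ g⁻¹ f) O i else 0) O i =
      if R (g⁻¹ • i) then f O i else 0 := by
    intro g
    rw [key]
    congr 1
    have : (MX c hc).ρ g ((MX c hc).ρ g⁻¹ f) = f := by
      have := congrArg (fun φ : AddMonoid.End (KX p X) => φ f) ((MX c hc).ρ.map_mul g g⁻¹)
      simp only [mul_inv_cancel, map_one] at this
      exact this.symm
    rw [this]
  rw [Finset.sum_apply, Finset.sum_apply]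
  refine (Finset.sum_congr rfl fun g _ => e g).trans ?_
  obtain ⟨g, hg⟩ := hR i
  simp [hg]

end act
end CE


namespace CE

/-- labelled sets -/
structure XD (p : ℕ) (A : Type) [Group A] where
  X : Type
  ft : Fintype X
  lo : LinearOrder X
  ac : MulAction A X
  c : A → X → ZMod p
  hc : ∀ g h x, c (g * h) x = c h x + c g (h • x)
  hf : ∀ g : A, g ≠ 1 → ∃ x : X, g • x = x ∧ c g x ≠ 0

attribute [instance] XD.ft XD.lo XD.ac

section ex
set_option linter.unusedSectionVars false

lemma exists_lo (X : Type) [Fintype X] : Nonempty (LinearOrder X) :=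
  ⟨LinearOrder.lift' (Fintype.equivFin X) (Fintype.equivFin X).injective⟩

variable {p : ℕ} {A : Type} [Group A]

open Classical in
/-- logarithm -/
noncomputable def lam (p : ℕ) (a u : A) : ZMod p :=
  if h : ∃ k : ℤ, a ^ k = u then (h.choose : ZMod p) else 0

lemma lam_zpow (a : A) (hpa : p ∣ orderOf a) (k : ℤ) : lam p a (a ^ k) = k := by
  have h : ∃ l : ℤ, a ^ l = a ^ k := ⟨k, rfl⟩
  rw [lam, dif_pos h]
  have h1 := h.choose_spec
  have h2 : (orderOf a : ℤ) ∣ k - h.choose := by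
    rw [orderOf_dvd_iff_zpow_eq_one, zpow_sub, h1, mul_inv_cancel]
  rw [← sub_eq_zero, ← Int.cast_sub, ZMod.intCast_zmod_eq_zero_iff_dvd]
  have h3 : (p : ℤ) ∣ orderOf a := by exact_mod_cast hpa
  have := h3.trans h2
  rw [← neg_sub]; exact this.neg_right

lemma lam_mul (a : A) (hpa : p ∣ orderOf a) (u v : A) (hu : u ∈ Subgroup.zpowers a)
    (hv : v ∈ Subgroup.zpowers a) : lam p a (u * v) = lam p a u + lam p a v := by
  obtain ⟨k, rfl⟩ := hu
  obtain ⟨l, rfl⟩ := hv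
  simp only
  rw [← zpow_add, lam_zpow a hpa, lam_zpow a hpa, lam_zpow a hpa]; push_cast; rfl

/-- cocycle for one element -/
noncomputable def ca (p : ℕ) (a g : A) (x : A ⧸ Subgroup.zpowers a) : ZMod p :=
  lam p a ((g • x).out⁻¹ * g * x.out)

lemma ca_mem (a g : A) (x : A ⧸ Subgroup.zpowers a) :
    (g • x).out⁻¹ * g * x.out ∈ Subgroup.zpowers a := by
  rw [mul_assoc, ← QuotientGroup.eq, QuotientGroup.out_eq']
  conv_lhs => rw [← QuotientGroup.out_eq' x]
  rfl

lemma ca_mul (a : A) (hpa : p ∣ orderOf a) (g h : A) (x : A ⧸ Subgroup.zpowers a) :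
    ca p a (g * h) x = ca p a h x + ca p a g (h • x) := by
  rw [add_comm, ca, ca, ca, ← lam_mul a hpa _ _ (ca_mem _ _ _) (ca_mem _ _ _), mul_smul]
  congr 1
  group

lemma ca_self (a : A) (hpa : p ∣ orderOf a) :
    a • ((1 : A) : A ⧸ Subgroup.zpowers a) = ((1 : A) : A ⧸ Subgroup.zpowers a) ∧
      ca p a a ((1 : A) : A ⧸ Subgroup.zpowers a) = 1 := by
  have h1 : a • ((1 : A) : A ⧸ Subgroup.zpowers a) = ((1 : A) : A ⧸ Subgroup.zpowers a) := by
    change ((a * 1 : A) : A ⧸ Subgroup.zpowers a) = _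
    rw [QuotientGroup.eq]
    simp
  refine ⟨h1, ?_⟩
  rw [ca, h1]
  have h2 : ((1 : A) : A ⧸ Subgroup.zpowers a).out ∈ Subgroup.zpowers a := by
    have : ((1 : A) : A ⧸ Subgroup.zpowers a) = (((1 : A) : A ⧸ Subgroup.zpowers a).out : A ⧸ Subgroup.zpowers a) :=
      (QuotientGroup.out_eq' _).symm
    rw [QuotientGroup.eq] at this
    simpa using this
  obtain ⟨k, hk⟩ := h2
  simp only at hk
  rw [← hk]
  have : (a ^ k)⁻¹ * a * a ^ k = a ^ (1 : ℤ) := by group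
  rw [this, lam_zpow a hpa]; simp

lemma exists_XD (hp : p.Prime) [Finite A] (hA : IsPGroup p A) : Nonempty (XD p A) := by
  classical
  have : Fact p.Prime := ⟨hp⟩
  have hd : ∀ a : {a : A // a ≠ 1}, p ∣ orderOf a.1 := by
    rintro ⟨a, ha⟩
    obtain ⟨k, hk⟩ := (IsPGroup.iff_orderOf.1 hA) a
    rw [hk]
    apply dvd_pow_self
    rintro rfl
    rw [pow_zero, orderOf_eq_one_iff] at hk
    exact ha hk
  have : Fintype (Σ a : {a : A // a ≠ 1}, A ⧸ Subgroup.zpowers a.1) := Fintype.ofFinite _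
  obtain ⟨lo⟩ := exists_lo (Σ a : {a : A // a ≠ 1}, A ⧸ Subgroup.zpowers a.1)
  refine ⟨⟨Σ a : {a : A // a ≠ 1}, A ⧸ Subgroup.zpowers a.1, inferInstance, lo, inferInstance,
    fun g x => ca p x.1.1 g x.2, ?_, ?_⟩⟩
  · rintro g h ⟨a, x⟩
    exact ca_mul a.1 (hd a) g h x
  · intro g hg
    refine ⟨⟨⟨g, hg⟩, ((1 : A) : A ⧸ Subgroup.zpowers g)⟩, ?_, ?_⟩
    · exact congrArg (Sigma.mk (⟨g, hg⟩ : {a : A // a ≠ 1})) (ca_self g (hd ⟨g, hg⟩)).1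
    · simp only
      rw [(ca_self g (hd ⟨g, hg⟩)).2]
      exact one_ne_zero

end ex
end CE


namespace CE
open MvPolynomial

section poly
set_option linter.unusedSectionVars false
variable {X : Type}

lemma homog_coeff {ι : Type} (r : ι → Po X) (t : ℕ) (hr : ∀ i, (r i).IsHomogeneous t)
    (s : Finset ι) : ∀ d, (∀ n, n + d * t = t * s.card →
      ((∏ i ∈ s, (Polynomial.X - Polynomial.C (r i))).coeff d).IsHomogeneous n) ∧
      (s.card < d → (∏ i ∈ s, (Polynomial.X - Polynomial.C (r i))).coeff d = 0) := by
  classical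
  induction s using Finset.induction_on with
  | empty =>
    intro d
    simp only [Finset.prod_empty, Finset.card_empty, mul_zero, Polynomial.coeff_one]
    refine ⟨fun n hn => ?_, fun h => if_neg (by omega)⟩
    have : n = 0 := by omega
    subst this
    split_ifs
    · exact isHomogeneous_one X ℤ
    · exact isHomogeneous_zero X ℤ 0
  | insert i s hi ih =>
    intro d
    rw [Finset.prod_insert hi, Finset.card_insert_of_notMem hi]
    set P := ∏ i ∈ s, (Polynomial.X - Polynomial.C (r i)) with hP
    cases d with
    | zero =>
      refine ⟨fun n hn => ?_, fun h => by omega⟩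
      have e : ((Polynomial.X - Polynomial.C (r i)) * P).coeff 0 = -(r i * P.coeff 0) := by
        simp [sub_mul]
      rw [e]
      have hn' : n = t + t * s.card := by rw [mul_add] at hn; omega
      rw [hn']
      exact ((hr i).mul ((ih 0).1 _ (by simp))).neg
    | succ d =>
      have e : ((Polynomial.X - Polynomial.C (r i)) * P).coeff (d + 1) =
          P.coeff d - r i * P.coeff (d + 1) := by
        simp [sub_mul]
      rw [e]
      refine ⟨fun n hn => ?_, fun h => ?_⟩
      · have h1 : n + d * t = t * s.card := by
          have : n + d * t + t = t * s.card + t := by linarith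
          omega
        apply ((ih d).1 n h1).sub
        by_cases hd : s.card < d + 1
        · rw [(ih (d + 1)).2 hd, mul_zero]; exact isHomogeneous_zero X ℤ n
        · obtain ⟨k, hk⟩ : ∃ k, s.card = d + 1 + k := ⟨s.card - (d + 1), by omega⟩
          have h2 : n = t + t * k := by
            rw [hk] at h1
            have : n + d * t = (t + t * k) + d * t := by rw [h1]; ring
            omega
          rw [h2]
          exact (hr i).mul ((ih (d + 1)).1 _ (by rw [hk]; ring))
      · rw [(ih d).2 (by omega), (ih (d + 1)).2 (by omega)]; simp

variable {A : Type} [Group A] [Fintype A] [MulAction A X]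

/-- orbit polynomial -/
noncomputable def op (A : Type) [Group A] [Fintype A] [MulAction A X] (t : ℕ) (x : X) : Polynomial (Po X) :=
  ∏ a : A, (Polynomial.X - Polynomial.C ((MvPolynomial.X (a • x) : Po X) ^ t))

lemma op_inv (t : ℕ) (x : X) (d : ℕ) (g : A) :
    rename (fun y => g • y) ((op A t x).coeff d) = (op A t x).coeff d := by
  have h : (op A t x).map (rename (fun y => g • y) : Po X →ₐ[ℤ] Po X).toRingHom = op A t x := by
    rw [op, Polynomial.map_prod]
    rw [← Equiv.prod_comp (Equiv.mulLeft g) (fun a => Polynomial.X - Polynomial.C ((MvPolynomial.X (a • x) : Po X) ^ t))]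
    refine Finset.prod_congr rfl fun a _ => ?_
    simp [mul_smul]
  conv_rhs => rw [← h]
  rw [Polynomial.coeff_map]; rfl

lemma op_homog (t : ℕ) (x : X) (d k : ℕ) (h : k + d = Fintype.card A) :
    ((op A t x).coeff d).IsHomogeneous (t * k) := by
  refine (homog_coeff (fun a : A => (MvPolynomial.X (a • x) : Po X) ^ t) t ?_ Finset.univ d).1 _ ?_
  · intro a
    simpa using (isHomogeneous_X ℤ (a • x)).pow t
  · rw [Finset.card_univ, ← h]; ring

lemma op_monic (t : ℕ) (x : X) : (op A t x).Monic :=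
  Polynomial.monic_prod_of_monic _ _ fun a _ => Polynomial.monic_X_sub_C _

lemma op_natDegree (t : ℕ) (x : X) : (op A t x).natDegree = Fintype.card A := by
  rw [op, Polynomial.natDegree_prod_of_monic _ _ fun a _ => Polynomial.monic_X_sub_C _]
  simp only [Polynomial.natDegree_X_sub_C]; simp

lemma op_eval (t : ℕ) (x : X) : (op A t x).eval ((MvPolynomial.X x : Po X) ^ t) = 0 := by
  rw [op, Polynomial.eval_prod]
  exact Finset.prod_eq_zero (Finset.mem_univ 1) (by simp)

end poly

section fg
set_option linter.unusedSectionVars false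

/-- integrality criterion -/
lemma finite_adjoin {X I : Type} [Fintype X] [Finite I] (r : I → Po X) (t : ℕ) (ht : 0 < t)
    (h : ∀ x : X, ∃ P : Polynomial (Po X), P.Monic ∧
      P.eval ((MvPolynomial.X x : Po X) ^ t) = 0 ∧
      ∀ d, d < P.natDegree → P.coeff d ∈ Set.range r) :
    IsNoetherianRing (Algebra.adjoin ℤ (Set.range r)) ∧
      Module.Finite (Algebra.adjoin ℤ (Set.range r)) (Po X) := by
  set S := Algebra.adjoin ℤ (Set.range r) with hS
  have hfg : S.FG := ⟨(Set.finite_range r).toFinset, by rw [Set.Finite.coe_toFinset]⟩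
  have hn : IsNoetherianRing S := isNoetherianRing_of_fg hfg
  refine ⟨hn, ?_⟩
  have hInt : ∀ x : X, IsIntegral S (MvPolynomial.X x : Po X) := by
    intro x
    apply IsIntegral.of_pow ht
    obtain ⟨P, hm, he, hc⟩ := h x
    have hl : P ∈ Polynomial.lifts (algebraMap S (Po X)) := by
      rw [Polynomial.lifts_iff_coeff_lifts]
      intro d
      rcases lt_trichotomy d P.natDegree with hd | hd | hd
      · exact ⟨⟨_, Algebra.subset_adjoin (hc d hd)⟩, rfl⟩
      · rw [hd, hm.coeff_natDegree]; exact ⟨1, map_one _⟩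
      · rw [Polynomial.coeff_eq_zero_of_natDegree_lt hd]; exact ⟨0, map_zero _⟩
    obtain ⟨Q, hQ, -, hQm⟩ := Polynomial.lifts_and_natDegree_eq_and_monic hl hm
    refine ⟨Q, hQm, ?_⟩
    rw [← Polynomial.eval_map, hQ, he]
  have hI : Algebra.IsIntegral S (Po X) := by
    refine ⟨fun P => ?_⟩
    induction P using MvPolynomial.induction_on with
    | C n => exact isIntegral_algebraMap (R := S) (x := algebraMap ℤ S n)
    | add a b ha hb => exact ha.add hb
    | mul_X a x ha => exact ha.mul (hInt x)
  have hft : Algebra.FiniteType S (Po X) := Algebra.FiniteType.of_restrictScalars_finiteType ℤ S (Po X)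
  exact Algebra.IsIntegral.finite

end fg
end CE


namespace CE
open MvPolynomial

section fin
set_option linter.unusedSectionVars false
variable {p : ℕ} [NeZero p] {X : Type} [Fintype X] [LinearOrder X]
variable {G : Type} [Group G] [MulAction G X] (c : G → X → ZMod p)

/-- invariant cocycles -/
def IZ (hc : ∀ g h x, c (g * h) x = c h x + c g (h • x)) (ζ : KX p X) : Prop :=
  (∀ g, (MX c hc).ρ g ζ = ζ) ∧ (MX c hc).D ζ = 0

lemma IZ_add (hc : ∀ g h x, c (g * h) x = c h x + c g (h • x)) {ζ ξ : KX p X} (h : IZ c hc ζ)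
    (h' : IZ c hc ξ) : IZ c hc (ζ + ξ) :=
  ⟨fun g => by rw [map_add, h.1, h'.1], by rw [map_add, h.2, h'.2, add_zero]⟩

lemma IZ_zero (hc : ∀ g h x, c (g * h) x = c h x + c g (h • x)) : IZ c hc (0 : KX p X) :=
  ⟨fun g => map_zero _, map_zero _⟩

lemma ρ_smul (hc : ∀ g h x, c (g * h) x = c h x + c g (h • x)) (g : G) (r : Po X) (f : KX p X) :
    (MX c hc).ρ g (r • f) = rename (fun y => g • y) r • (MX c hc).ρ g f :=
  T_smul (em g) (c g) r f

lemma D_smul (hc : ∀ g h x, c (g * h) x = c h x + c g (h • x)) (r : Po X) (f : KX p X) :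
    (MX c hc).D (r • f) = r • (MX c hc).D f :=
  DX_smul r f

lemma IZ_smul (hc : ∀ g h x, c (g * h) x = c h x + c g (h • x)) {ζ : KX p X} (h : IZ c hc ζ)
    (r : Po X) (hr : ∀ g : G, rename (fun y => g • y) r = r) : IZ c hc (r • ζ) :=
  ⟨fun g => by rw [ρ_smul, h.1, hr], by rw [D_smul, h.2, smul_zero]⟩

theorem hfin_of (hc : ∀ g h x, c (g * h) x = c h x + c g (h • x)) {I : Type} [Fintype I]
    (r : I → Po X) (hr : ∀ k (g : G), rename (fun y => g • y) (r k) = r k)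
    (h1 : IsNoetherianRing (Algebra.adjoin ℤ (Set.range r)))
    (h2 : Module.Finite (Algebra.adjoin ℤ (Set.range r)) (Po X)) :
    ∃ N : ℕ, ∀ ζ, IZ c hc ζ → ∃ ζ0, (∀ m, N ≤ m → (MX c hc).pr m ζ0 = 0) ∧
      ∃ ζs : I → KX p X, (∀ k, IZ c hc (ζs k)) ∧ ζ = ζ0 + ∑ k, r k • ζs k := by
  classical
  set S := Algebra.adjoin ℤ (Set.range r) with hS
  have hSr : ∀ a ∈ S, ∀ g : G, rename (fun y => g • y) a = a := by
    intro a ha g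
    have hle : S ≤ AlgHom.equalizer (rename (fun y => g • y) : Po X →ₐ[ℤ] Po X) (AlgHom.id ℤ (Po X)) := by
      apply Algebra.adjoin_le
      rintro _ ⟨k, rfl⟩
      exact hr k g
    exact hle ha
  let Z : Submodule S (KX p X) :=
    { carrier := {ζ | IZ c hc ζ}
      add_mem' := fun h h' => IZ_add c hc h h'
      zero_mem' := IZ_zero c hc
      smul_mem' := fun a ζ h => IZ_smul c hc h a.1 (hSr a.1 a.2) }
  have hfin : Module.Finite S (KX p X) := inferInstance
  have hnoe : IsNoetherian S (KX p X) := isNoetherian_of_isNoetherianRing_of_finite S _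
  obtain ⟨B, hB⟩ := IsNoetherian.noetherian Z
  have hbd : ∃ N : ℕ, ∀ b ∈ B, ∀ m, N ≤ m → (MX c hc).pr m b = 0 := by
    choose n hn using fun b : KX p X => prX_bdd b
    refine ⟨B.sup n, fun b hb m hm => hn b m (le_trans (Finset.le_sup hb) hm)⟩
  obtain ⟨N, hN⟩ := hbd
  refine ⟨N, ?_⟩
  let W : KX p X → Prop := fun ζ => IZ c hc ζ ∧ ∃ ζ0, (∀ m, N ≤ m → (MX c hc).pr m ζ0 = 0) ∧
      ∃ ζs : I → KX p X, (∀ k, IZ c hc (ζs k)) ∧ ζ = ζ0 + ∑ k, r k • ζs k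
  have Wadd : ∀ ζ ξ, W ζ → W ξ → W (ζ + ξ) := by
    rintro ζ ξ ⟨a, ζ0, b, ζs, d, e⟩ ⟨a', ξ0, b', ξs, d', e'⟩
    refine ⟨IZ_add c hc a a', ζ0 + ξ0, fun m hm => ?_, fun k => ζs k + ξs k,
      fun k => IZ_add c hc (d k) (d' k), ?_⟩
    · rw [map_add, b m hm, b' m hm, add_zero]
    · rw [e, e']
      simp only [smul_add, Finset.sum_add_distrib]
      abel
  have Wz : ∀ (n : ℤ) ζ, W ζ → W (n • ζ) := by
    rintro n ζ ⟨a, ζ0, b, ζs, d, e⟩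
    refine ⟨⟨fun g => ?_, ?_⟩, n • ζ0, fun m hm => ?_, fun k => n • ζs k,
      fun k => ⟨fun g => ?_, ?_⟩, ?_⟩
    · rw [map_zsmul, a.1]
    · rw [map_zsmul, a.2, smul_zero]
    · rw [map_zsmul, b m hm, smul_zero]
    · rw [map_zsmul, (d k).1]
    · rw [map_zsmul, (d k).2, smul_zero]
    · rw [e, smul_add, Finset.smul_sum]
      congr 1
      exact Finset.sum_congr rfl fun k _ => smul_comm _ _ _
  have Ws : ∀ a ∈ S, ∀ ζ, W ζ → W (a • ζ) := by
    intro a ha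
    induction ha using Algebra.adjoin_induction with
    | mem a ha =>
      obtain ⟨k, rfl⟩ := ha
      intro ζ hζ
      refine ⟨IZ_smul c hc hζ.1 _ (hr k), 0, fun m _ => map_zero _, fun l => if l = k then ζ else 0,
        fun l => ?_, ?_⟩
      · beta_reduce
        split_ifs
        · exact hζ.1
        · exact IZ_zero c hc
      · rw [zero_add, Finset.sum_eq_single k]
        · simp
        · intro l _ hl; simp [hl]
        · simp
    | algebraMap n =>
      intro ζ hζ
      rw [algebraMap_smul]
      exact Wz n ζ hζ
    | add a b _ _ ha hb =>
      intro ζ hζ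
      rw [add_smul]; exact Wadd _ _ (ha ζ hζ) (hb ζ hζ)
    | mul a b _ _ ha hb =>
      intro ζ hζ
      rw [mul_smul]; exact ha _ (hb ζ hζ)
  have main : ∀ ζ ∈ Submodule.span S (B : Set (KX p X)), W ζ := by
    intro ζ hζ
    induction hζ using Submodule.span_induction with
    | mem b hb =>
      have hbZ : b ∈ Z := hB ▸ Submodule.subset_span hb
      refine ⟨hbZ, b, hN b hb, 0, fun k => IZ_zero c hc, ?_⟩
      simp
    | zero =>
      refine ⟨IZ_zero c hc, 0, fun m _ => map_zero _, 0, fun k => IZ_zero c hc, ?_⟩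
      simp
    | add a b _ _ ha hb => exact Wadd _ _ ha hb
    | smul a x _ hx => exact Ws a.1 a.2 x hx
  intro ζ hζ
  exact (main ζ (by rw [hB]; exact hζ)).2

end fin
end CE


namespace CE
open MvPolynomial

section prod
set_option linter.unusedSectionVars false

theorem ev_prod (p : ℕ) [NeZero p] {G : Type} [Group G] [Finite G] {J : Type} [Finite J]
    (A : J → Type) [∀ j, Group (A j)] [∀ j, Finite (A j)] (φ : ∀ j, G →* A j)
    (hφ : ∀ g, (∀ j, φ j g = 1) → g = 1) (D : ∀ j, XD p (A j)) (q : ℤ)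
    (hE : ∀ j, Ev (A j) q) : Ev G q := by
  classical
  have : Fintype G := Fintype.ofFinite G
  have : Fintype J := Fintype.ofFinite J
  have : ∀ j, Fintype (A j) := fun j => Fintype.ofFinite _
  obtain ⟨lo⟩ := exists_lo (Σ j, (D j).X)
  let actj : ∀ j, MulAction G (D j).X := fun j => MulAction.compHom _ (φ j)
  have sm : ∀ (g : G) (x : Σ j, (D j).X), g • x = ⟨x.1, φ x.1 g • x.2⟩ := fun g x => rfl
  let c : G → (Σ j, (D j).X) → ZMod p := fun g x => (D x.1).c (φ x.1 g) x.2
  have hc : ∀ g h x, c (g * h) x = c h x + c g (h • x) := by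
    rintro g h ⟨j, x⟩
    change (D j).c (φ j (g * h)) x = (D j).c (φ j h) x + (D j).c (φ j g) (φ j h • x)
    rw [map_mul, (D j).hc]
  have hf : ∀ g : G, g ≠ 1 → ∃ x, g • x = x ∧ c g x ≠ 0 := by
    intro g hg
    have : ¬ ∀ j, φ j g = 1 := fun h => hg (hφ g h)
    push Not at this
    obtain ⟨j, hj⟩ := this
    obtain ⟨x, hx, hx'⟩ := (D j).hf _ hj
    exact ⟨⟨j, x⟩, congrArg (Sigma.mk j) hx, hx'⟩
  choose d hd using hE
  obtain ⟨t, ht0, ht⟩ : ∃ t : ℕ, 0 < t ∧ ∀ j, d j ≤ t :=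
    ⟨Finset.univ.sup d + 1, by omega, fun j => (Finset.le_sup (Finset.mem_univ j)).trans (by omega)⟩
  let I := Σ j, (D j).X × Fin (Fintype.card (A j))
  let e : ∀ j, (D j).X ↪ (Σ j, (D j).X) := fun j =>
    Function.Embedding.sigmaMk (β := fun j => (D j).X) j
  let r' : ∀ k : I, Po (D k.1).X := fun k => (op (A k.1) t k.2.1).coeff k.2.2
  let r : I → Po (Σ j, (D j).X) := fun k => rename (e k.1) (r' k)
  have hr : ∀ k (g : G), rename (fun y => g • y) (r k) = r k := by
    intro k g
    have h1 := op_inv t k.2.1 k.2.2 (φ k.1 g)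
    have h2 : rename (fun y => g • y) (r k) = rename (e k.1) (rename (fun y => φ k.1 g • y) (r' k)) := by
      simp only [r, rename_rename]
      rfl
    rw [h2]
    exact congrArg (rename (e k.1)) h1
  obtain ⟨hn1, hn2⟩ := finite_adjoin r t ht0 (by
    rintro ⟨j, x⟩
    refine ⟨(op (A j) t x).map (rename (e j) : Po (D j).X →ₐ[ℤ] _).toRingHom,
      (op_monic t x).map _, ?_, ?_⟩
    · have h1 : ((MvPolynomial.X (⟨j, x⟩ : Σ j, (D j).X) : Po (Σ j, (D j).X)) ^ t) =
        (rename (e j) : Po (D j).X →ₐ[ℤ] _).toRingHom ((MvPolynomial.X x : Po (D j).X) ^ t) := by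
        simp [e]
      rw [h1, Polynomial.eval_map_apply, op_eval, map_zero]
    · intro m hm
      rw [(op_monic t x).natDegree_map, op_natDegree] at hm
      refine ⟨⟨j, x, ⟨m, hm⟩⟩, ?_⟩
      rw [Polynomial.coeff_map]; rfl)
  obtain ⟨N, hN⟩ := hfin_of c hc r hr hn1 hn2
  refine ev_of_dgm (MX c hc) (MX_free c hc hf) q
    (fun k => DistribSMul.toAddMonoidHom (KX p (Σ j, (D j).X)) (r k)) ?_ ?_ ?_ N ?_
  · intro k g x
    change r k • _ = (MX c hc).ρ g (r k • x)
    rw [ρ_smul, hr]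
  · intro k x
    change r k • _ = (MX c hc).D (r k • x)
    rw [D_smul]
  · rintro ⟨j, x, m⟩
    set Q := MX (D j).c (D j).hc with hQ
    set k : I := ⟨j, x, m⟩ with hk
    have hhom : (r' k).IsHomogeneous (t * (Fintype.card (A j) - m)) :=
      op_homog (A := A j) t x m _ (Nat.sub_add_cancel m.2.le)
    have h1 : ∃ f, (sgl (q • (mη (r' k) : KX p (D j).X)) : List (A j) → KX p (D j).X) = dt Q.ρ Q.D f := by
      have hle : t ≤ t * (Fintype.card (A j) - m) :=
        Nat.le_mul_of_pos_right _ (by have := m.2; omega)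
      apply kill_of_ev Q q (hd j) (2 * (t * (Fintype.card (A j) - m)) - 1)
      · have := ht j; omega
      · intro g
        change T (em g) _ (mη (r' k)) = _
        rw [T_mη]
        congr 1
        exact op_inv t x m g
      · change DX _ = _
        rw [← smul_ηX, DX_smul, DX_ηX, smul_zero]
      · change prX _ _ = _
        rw [prX_hom _ _ hhom, if_pos (by omega)]
    obtain ⟨f, hf⟩ := sgl_inflate (MX c hc) Q (φ j) (T (e j) (fun _ => 0)) (by
      intro g x
      change T _ _ (T (em (φ j g)) ((D j).c (φ j g)) x) = T (em g) (c g) (T _ _ x)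
      rw [T_trans, T_trans]
      have he : (em (φ j g)).trans (e j) = (e j).trans (em g) := DFunLike.ext _ _ fun y => rfl
      have hs : (fun w => (D j).c (φ j g) w + 0) = fun w => 0 + c g (e j w) := by
        funext w; rw [add_zero, zero_add]; rfl
      rw [he, hs]) (T_DX _ _) _ h1
    refine ⟨f, ?_⟩
    rw [← hf, map_zsmul, T_mη]
    congr 2
    exact smul_ηX (r k)
  · intro ζ hρ hD
    obtain ⟨ζ0, a, ζs, b, e⟩ := hN ζ ⟨hρ, hD⟩
    exact ⟨ζ0, a, ζs, b, e⟩

end prod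
end CE


namespace CE

section idx
set_option linter.unusedSectionVars false
variable {G : Type} [Group G] {K : Type} [AddCommGroup K]

lemma exact_inv (M : DGM G K) [Fintype G] (hF : IsFree M.ρ) (k : K) (n : ℕ) (f : List G → K)
    (hf : ∀ l, n < l.length → f l = 0) (hd : dt M.ρ M.D f = sgl k) :
    ∃ ξ : K, (∀ g, M.ρ g ξ = ξ) ∧ M.D ξ = k := by
  obtain ⟨θ, hθ⟩ := hF
  induction n generalizing f with
  | zero =>
    refine ⟨f [], ?_, ?_⟩
    · intro g
      have := congrFun hd [g]
      simp [dt, dG, ad, bd_cons, mg, tw, hf [g], sgl] at this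
      exact sub_eq_zero.mp this
    · have := congrFun hd []
      simpa [dt, dG, ad, tw, sgl] using this
  | succ n ih =>
    set h := hG M.ρ θ f with hh
    refine ih (f - dt M.ρ M.D h) ?_ (by rw [dt_sub, dt_dt, hd, sub_zero])
    intro l hl
    have hne : l ≠ [] := by rintro rfl; simp at hl
    have h0 := hG_spec M.ρ θ hθ f l hne
    have hz : h l = 0 := by
      simp only [hh, hG]
      refine Finset.sum_eq_zero fun x _ => ?_
      rw [hf _ (by simpa using hl)]; simp
    have hz2 : hG M.ρ θ (dG M.ρ f) l = 0 := by
      simp only [hG]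
      refine Finset.sum_eq_zero fun x _ => ?_
      have := congrFun hd (x⁻¹ :: l)
      simp only [dt, Pi.add_apply, tw] at this
      rw [hf (x⁻¹ :: l) (by simpa using hl)] at this
      simp [sgl] at this
      rw [this]; simp
    rw [hz2, add_zero] at h0
    simp [dt, tw, hz, ← hh ▸ h0]

lemma dt_sgl_inv (M : DGM G K) (k : K) (hk : ∀ g, M.ρ g k = k) :
    dt M.ρ M.D (sgl k) = sgl (M.D k) := by
  have hb : ∀ l : List G, bd (0 : List G → K) l = 0 := fun l => by rw [bd_zero]; rfl
  funext l
  rcases l with _ | ⟨g, _ | ⟨h, l⟩⟩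
  · simp [dt, dG, ad, tw, sgl]
  · simp [dt, dG, ad, tw, sgl, bd_cons, mg, hk]
  · have : sh g (sgl k) = 0 := rfl
    simp [dt, dG, ad, tw, sgl, bd_cons (sgl k), mg, this, hb]

/-- restriction to a subgroup -/
def DGM.rst (M : DGM G K) (N : Subgroup G) : DGM N K :=
  { ρ := M.ρ.comp N.subtype
    D := M.D
    DD := M.DD
    Dρ := fun g x => M.Dρ g x
    pr := M.pr
    prρ := fun n g x => M.prρ n g x
    prD := M.prD
    prD0 := M.prD0
    prpr := M.prpr
    pr_ext := M.pr_ext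
    pr_bdd := M.pr_bdd
    η := M.η
    ρη := fun g => M.ρη g
    Dη := M.Dη
    prη := M.prη
    prη' := M.prη'
    ε := M.ε
    εη := M.εη
    S := M.S
    prS := M.prS
    hS := M.hS }

lemma dt_rst (M : DGM G K) (N : Subgroup G) (f : List G → K) (l : List N) :
    dt (M.rst N).ρ (M.rst N).D (fun l : List N => f (l.map N.subtype)) l =
      dt M.ρ M.D f (l.map N.subtype) := by
  have h4 : ad (M.rst N).ρ (fun l : List N => f (l.map N.subtype)) l =
      ad M.ρ f (l.map N.subtype) := by
    cases l with
    | nil => simp [ad]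
    | cons g l => simp [ad, DGM.rst]
  simp only [dt, dG, tw, Pi.add_apply, Pi.sub_apply]
  rw [h4, bd_comap N.subtype f l, List.length_map]
  rfl

lemma dG_rst (N : Subgroup G) (z : List G → ℤ) (l : List N) :
    dG 1 (fun l : List N => z (l.map N.subtype)) l = dG 1 z (l.map N.subtype) := by
  simp only [dG, Pi.sub_apply]
  rw [bd_comap N.subtype z l]
  cases l <;> simp [ad]

lemma transfer (M : DGM G K) [Finite G] (N : Subgroup G) (ξ ζ : K)
    (hξ : ∀ g : N, M.ρ g ξ = ξ) (hζ : ∀ g, M.ρ g ζ = ζ) (h : M.D ξ = ζ) :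
    ∃ ξ' : K, (∀ g, M.ρ g ξ' = ξ') ∧ M.D ξ' = (N.index : ℤ) • ζ := by
  classical
  have : Fintype (G ⧸ N) := Fintype.ofFinite _
  have mm : ∀ a b x, M.ρ (a * b) x = M.ρ a (M.ρ b x) := fun a b x => by rw [map_mul]; rfl
  have key : ∀ a b : G, (a : G ⧸ N) = b → M.ρ a ξ = M.ρ b ξ := by
    intro a b hab
    have := hξ ⟨a⁻¹ * b, QuotientGroup.eq.mp hab⟩
    change M.ρ (a⁻¹ * b) ξ = ξ at this
    conv_lhs => rw [← this, ← mm]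
    rw [mul_inv_cancel_left]
  refine ⟨∑ t : G ⧸ N, M.ρ t.out ξ, ?_, ?_⟩
  · intro g
    rw [map_sum, ← Equiv.sum_comp (MulAction.toPerm g) (fun t : G ⧸ N => M.ρ t.out ξ)]
    refine Finset.sum_congr rfl fun t _ => ?_
    rw [← mm]
    apply key
    rw [MulAction.toPerm_apply, QuotientGroup.out_eq']
    conv_rhs => rw [← QuotientGroup.out_eq' t]
    rfl
  · rw [map_sum]
    simp only [M.Dρ, h, hζ]
    simp [Subgroup.index, Nat.card_eq_fintype_card]

theorem ev_index_dgm [Fintype G] (M : DGM G K) (hF : IsFree M.ρ) (N : Subgroup G) [Fintype N]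
    (hFN : IsFree (M.rst N).ρ) (q : ℤ) (hE : Ev N q) : Ev G (N.index * q) := by
  obtain ⟨d, hd⟩ := hE
  refine ⟨d + 1, ?_⟩
  rintro (_ | i) hi z hz hdz
  · omega
  obtain ⟨h, ζ, hρ, hD, e⟩ := invar M hF (i + 1) (fun l => z l • M.η)
    (by intro l hl; simp [hz l (by omega)]) (by funext l; rw [dt_η, hdz]; simp)
  have eq1 : (fun l => z l • M.η) = dt M.ρ M.D (Pr M i h) + sgl (M.pr (i + 1) ζ) := by
    rw [Pr_dt, ← Pr_sgl, ← Pr_add, ← e, Pr_η]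
    funext l
    by_cases hl : l.length = i + 1
    · simp [res, hl]
    · simp [res, hl, hz l hl]
  set ζ1 := M.pr (i + 1) ζ with hζ1
  have hρ1 : ∀ g, M.ρ g ζ1 = ζ1 := by intro g; rw [hζ1, ← M.prρ, hρ]
  obtain ⟨w, hw⟩ := hd (i + 1) (by omega) (fun l : List N => z (l.map N.subtype))
    (by intro l hl; apply hz; simpa using hl) (by funext l; rw [dG_rst, hdz]; rfl)
  have hw' : q • (fun l : List N => z (l.map N.subtype)) = dG 1 (res i w) := by
    rw [dG_res, ← hw]
    funext l
    by_cases hl : l.length = i + 1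
    · simp [res, hl]
    · have h0 := hz (l.map N.subtype) (by simpa using hl)
      simp only [Pi.smul_apply, res, hl, h0, if_false, smul_zero]
  obtain ⟨ξ, hξ, hDξ⟩ := exact_inv (M.rst N) hFN (q • ζ1) i
    ((fun l : List N => res i w l • (M.rst N).η)
      - q • fun l : List N => Pr M i h (l.map N.subtype)) (by
      intro l hl
      have h1 : ¬ l.length ≤ i := by omega
      have h2 : l.length ≠ i := by omega
      simp [res, h2, Pr, h1]) (by
      rw [dt_sub, dt_zsmul]
      funext l
      have e2 := congrArg (fun x => q • x) (congrFun eq1 (l.map N.subtype))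
      simp only [Pi.add_apply, smul_add] at e2
      have e3 : (sgl ζ1 : List G → K) (l.map N.subtype) = sgl ζ1 l := by cases l <;> simp [sgl]
      rw [sgl_zsmul, Pi.sub_apply, Pi.smul_apply, Pi.smul_apply, dt_η, ← hw', dt_rst, ← e3,
        sub_eq_iff_eq_add', ← e2]
      simp only [Pi.smul_apply, smul_smul, smul_eq_mul]
      rfl)
  obtain ⟨ξ', hξ', hDξ'⟩ := transfer M N ξ (q • ζ1) hξ (by intro g; rw [map_zsmul, hρ1]) hDξ
  apply unit_inj M i ((N.index * q : ℤ) • z) (by intro l hl; simp [hz l hl])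
    ((N.index * q : ℤ) • Pr M i h + sgl ξ')
  rw [dt_add, dt_zsmul, dt_sgl_inv M ξ' hξ', hDξ', smul_smul, sgl_zsmul, ← smul_add, ← eq1]
  funext l; simp [smul_smul]

theorem ev_index (p : ℕ) [NeZero p] [Finite G] (D : XD p G) (N : Subgroup G) (q : ℤ)
    (hE : Ev N q) : Ev G (N.index * q) := by
  have := Fintype.ofFinite G
  have := Fintype.ofFinite N
  refine ev_index_dgm (MX D.c D.hc) (MX_free D.c D.hc D.hf) N ?_ q hE
  exact MX_free (G := N) (fun n x => D.c n x) (fun g h x => D.hc g h x) (by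
    intro g hg
    obtain ⟨x, h1, h2⟩ := D.hf g (by simpa using hg)
    exact ⟨x, h1, h2⟩)

lemma ev_mul {q : ℤ} (m : ℤ) (hE : Ev G q) : Ev G (m * q) := by
  obtain ⟨d, hd⟩ := hE
  refine ⟨d, fun i hi z hz h => ?_⟩
  refine hd i hi (m • z) ?_ ?_ |>.imp fun w hw => ?_
  · intro l hl; simp [hz l hl]
  · have e : m • z = fun l => (DistribSMul.toAddMonoidHom ℤ m) (z l) := by funext l; simp
    funext l
    rw [e, dG_map 1 1 _ (by intro g x; rfl), h]; simp
  · rw [← hw, smul_smul, mul_comm]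

end idx
end CE


namespace CE

section main
set_option linter.unusedSectionVars false

/-- the main claim at level n -/
def Claim (p n : ℕ) : Prop :=
  ∀ (G : Type) [Group G] [Finite G] (_ : IsPGroup p G) (J : Type) [Finite J]
    (H : J → Subgroup G) (_ : ∀ j, (H j).index ≤ p ^ n)
    (_ : ∀ x : G, (∀ j g, g * x * g⁻¹ ∈ H j) → x = 1), Ev G ((p : ℤ) ^ n)

lemma claim_one (p n : ℕ) (hp : p.Prime) (ih : ∀ m < n, Claim p m)
    (A : Type) [Group A] [Finite A] (hA : IsPGroup p A) (H : Subgroup A) (hH : H.index ≤ p ^ n)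
    (hc : ∀ x : A, (∀ g, g * x * g⁻¹ ∈ H) → x = 1) : Ev A ((p : ℤ) ^ n) := by
  have : Fact p.Prime := ⟨hp⟩
  have : NeZero p := ⟨hp.ne_zero⟩
  by_cases hT : H = ⊤
  · refine ev_prod p (J := Empty) (fun _ => Unit) (fun j => j.elim) ?_ (fun j => j.elim) _
      (fun j => j.elim)
    intro g _
    exact hc g (by simp [hT])
  obtain ⟨N, hN, hHN⟩ := (eq_top_or_exists_le_coatom H).resolve_left hT
  have : Group.IsNilpotent A := hA.isNilpotent
  have hnorm : N.Normal :=
    Subgroup.NormalizerCondition.normal_of_coatom N Group.normalizerCondition_of_isNilpotent hN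
  obtain ⟨a, ha⟩ := hA.index H
  obtain ⟨b, hb⟩ := hA.index N
  have han : a ≤ n := by
    rw [ha] at hH
    exact (Nat.pow_le_pow_iff_right hp.one_lt).mp hH
  have hb1 : b ≠ 0 := by
    rintro rfl
    rw [pow_zero, Subgroup.index_eq_one] at hb
    exact hN.1 hb
  have hba : b ≤ a := by
    have := Subgroup.index_dvd_of_le hHN
    rw [ha, hb] at this
    exact (Nat.pow_dvd_pow_iff_le_right hp.one_lt).mp this
  have hE : Ev N ((p : ℤ) ^ (a - b)) := by
    refine ih (a - b) (by omega) N (hA.to_subgroup N) A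
      (fun g => (H.comap (MulAut.conj g).toMonoidHom).subgroupOf N) ?_ ?_
    · intro g
      have h1 : H.comap (MulAut.conj g).toMonoidHom ≤ N := by
        intro x hx
        have h2 : g * x * g⁻¹ ∈ N := hHN hx
        have := hnorm.conj_mem _ h2 g⁻¹
        simpa [mul_assoc] using this
      have h2 := Subgroup.relIndex_mul_index h1
      rw [Subgroup.index_comap_of_surjective _ (MulAut.conj g).surjective, ha, hb,
        ← Nat.sub_add_cancel hba, pow_add] at h2
      exact (Nat.eq_of_mul_eq_mul_right (pow_pos hp.pos b) h2).le
    · intro x hx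
      apply Subtype.ext
      apply hc
      intro g
      have := hx g 1
      simpa [Subgroup.mem_subgroupOf] using this
  obtain ⟨D⟩ := exists_XD hp hA
  have h1 := ev_mul ((p : ℤ) ^ (n - a)) (ev_index p D N _ hE)
  rw [hb] at h1
  push_cast at h1
  rw [← pow_add, ← pow_add] at h1
  convert h1 using 2
  omega

theorem claim (p n : ℕ) (hp : p.Prime) : Claim p n := by
  induction n using Nat.strong_induction_on with
  | _ n ih =>
  intro G _ _ hG J _ H hind hcore
  have : NeZero p := ⟨hp.ne_zero⟩
  have hA : ∀ j, IsPGroup p (G ⧸ (H j).normalCore) := fun j => hG.to_quotient _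
  refine ev_prod p (fun j => G ⧸ (H j).normalCore) (fun j => QuotientGroup.mk' _) ?_
    (fun j => (exists_XD hp (hA j)).some) _ ?_
  · intro g hg
    apply hcore
    intro j a
    have := hg j
    rw [QuotientGroup.mk'_apply, QuotientGroup.eq_one_iff] at this
    exact this a
  · intro j
    have hcm : ((H j).map (QuotientGroup.mk' (H j).normalCore)).comap
        (QuotientGroup.mk' (H j).normalCore) = H j := by
      rw [QuotientGroup.comap_map_mk', sup_eq_right]
      exact (H j).normalCore_le
    refine claim_one p n hp ih _ (hA j) ((H j).map (QuotientGroup.mk' (H j).normalCore)) ?_ ?_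
    · rw [← Subgroup.index_comap_of_surjective _ (QuotientGroup.mk'_surjective _), hcm]
      exact hind j
    · intro x hx
      obtain ⟨y, rfl⟩ := QuotientGroup.mk'_surjective _ x
      rw [QuotientGroup.mk'_apply, QuotientGroup.eq_one_iff]
      intro a
      have := hx (QuotientGroup.mk' _ a)
      rw [← map_inv, ← map_mul, ← map_mul, ← Subgroup.mem_comap, hcm] at this
      exact this

end main
end CE


namespace CE

section link
set_option linter.unusedSectionVars false
variable {G : Type} [Group G]

lemma bd_ofFn {P : Type} [AddCommGroup P] (n : ℕ) (f : List G → P) (g : Fin (n + 1) → G) :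
    bd f (List.ofFn g) =
      ∑ j : Fin (n + 1), (-1 : ℤ) ^ (j : ℕ) • f (List.ofFn (Fin.contractNth j (· * ·) g)) := by
  induction n generalizing f with
  | zero => simp [bd_cons, mg]
  | succ n ih =>
    rw [List.ofFn_succ, bd_cons, ih, sub_eq_add_neg, ← Finset.sum_neg_distrib]
    refine Eq.trans ?_ (Fin.sum_univ_succ _).symm
    congr 1
    · rw [List.ofFn_succ]
      simp only [mg, Fin.val_zero, pow_zero, one_smul]
      congr 1
      rw [List.ofFn_succ]
      congr 1
    · refine Finset.sum_congr rfl fun j _ => ?_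
      rw [Fin.val_succ, pow_succ, mul_neg_one, neg_smul]
      congr 2
      simp only [sh]
      congr 1
      rw [List.ofFn_succ]
      congr 1
      congr 1
      funext k
      simp only [Fin.contractNth, Fin.val_succ]
      split_ifs <;> first | rfl | omega

open groupCohomology

lemma dG_ofFn (n : ℕ) (f : List G → ℤ) (c : (Fin n → G) → ℤ) (hc : ∀ g, f (List.ofFn g) = c g)
    (g : Fin (n + 1) → G) :
    dG 1 f (List.ofFn g) =
      (ModuleCat.Hom.hom (inhomogeneousCochains.d (Rep.trivial ℤ G ℤ) n)) c g := by
  rw [inhomogeneousCochains.d_hom_apply, dG, Pi.sub_apply, bd_ofFn, sub_eq_add_neg,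
    ← Finset.sum_neg_distrib]
  congr 1
  · rw [List.ofFn_succ]
    simp only [ad, hc]
    rfl
  · refine Finset.sum_congr rfl fun j _ => ?_
    rw [pow_succ, hc]
    simp

theorem link (q : ℕ) (hE : Ev G (q : ℤ)) :
    ∃ d, ∀ i, d ≤ i → ∀ x : groupCohomology (Rep.trivial ℤ G ℤ) i, q • x = 0 := by
  obtain ⟨d, hd⟩ := hE
  refine ⟨d + 1, ?_⟩
  rintro (_ | i) hi x
  · omega
  induction x using groupCohomology_induction_on with
  | _ y =>
  obtain ⟨c, hc⟩ : ∃ c : (Fin (i + 1) → G) → ℤ,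
    c = (iCocycles (Rep.trivial ℤ G ℤ) (i + 1)).hom y := ⟨_, rfl⟩
  let z : List G → ℤ := fun l => if h : l.length = i + 1 then
    c (fun k => l.get (k.cast h.symm)) else 0
  have hz : ∀ g, z (List.ofFn g) = c g := by
    intro g
    have h : (List.ofFn g).length = i + 1 := List.length_ofFn
    simp only [z, dif_pos h]
    congr 1
    funext k
    simp [-List.ofFn_succ]
  have hdc : (ModuleCat.Hom.hom (inhomogeneousCochains.d (Rep.trivial ℤ G ℤ) (i + 1))) c = 0 := by
    have h0 := (inhomogeneousCochains (Rep.trivial ℤ G ℤ)).iCycles_d (i + 1) (i + 2)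
    rw [inhomogeneousCochains.d_def] at h0
    rw [hc]
    exact congrArg (fun φ => φ.hom y) h0
  have hz0 : ∀ l, l.length ≠ i + 1 → z l = 0 := by intro l hl; simp [z, hl]
  have hdz : dG 1 z = 0 := by
    funext l
    by_cases hl : l.length = i + 2
    · obtain ⟨g, rfl⟩ : ∃ g : Fin (i + 2) → G, l = List.ofFn g := by
        generalize i + 2 = m at hl
        subst hl
        exact ⟨l.get, (List.ofFn_get l).symm⟩
      rw [dG_ofFn (i + 1) z c hz, hdc]; rfl
    · rw [dG_congr 1 _ 0, dG_zero']
      intro t ht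
      exact hz0 t (by omega)
  obtain ⟨w, hw⟩ := hd (i + 1) (by omega) z hz0 hdz
  let b : (Fin i → G) → ℤ := fun g => w (List.ofFn g)
  have hb : (ModuleCat.Hom.hom (inhomogeneousCochains.d (Rep.trivial ℤ G ℤ) i)) b = q • c := by
    funext g
    rw [← dG_ofFn i w b (fun _ => rfl), ← hw]
    rw [Pi.smul_apply, hz]
    simp
  have key : (toCocycles (Rep.trivial ℤ G ℤ) i (i + 1)).hom b = q • y := by
    apply (ModuleCat.mono_iff_injective (iCocycles (Rep.trivial ℤ G ℤ) (i + 1))).1 inferInstance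
    have h1 := (inhomogeneousCochains (Rep.trivial ℤ G ℤ)).toCycles_i i (i + 1)
    rw [inhomogeneousCochains.d_def] at h1
    refine (congrArg (fun φ => φ.hom b) h1).trans ?_
    refine hb.trans ?_
    rw [hc]
    exact (map_nsmul (iCocycles (Rep.trivial ℤ G ℤ) (i + 1)).hom q y).symm
  refine (map_nsmul (π (Rep.trivial ℤ G ℤ) (i + 1)).hom q y).symm.trans ?_
  rw [← key]
  exact congrArg (fun φ => φ.hom b)
    ((inhomogeneousCochains (Rep.trivial ℤ G ℤ)).toCycles_comp_homologyπ i (i + 1))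

end link
end CE

theorem cohomology_exponent_of_subgroups_trivial_core
    (p n k : ℕ) (hp : p.Prime) (G : Type) [Group G] [Finite G] (hG : IsPGroup p G)
    (H : Fin k → Subgroup G) (hind : ∀ j, (H j).index ≤ p ^ n)
    (hcore : (⨅ j, (H j).normalCore) = ⊥) :
    {i : ℕ | ¬ ∀ x : groupCohomology (Rep.trivial ℤ G ℤ) i, p ^ n • x = 0}.Finite := by
  have hE : CE.Ev G ((p ^ n : ℕ) : ℤ) := by
    push_cast
    refine CE.claim p n hp G hG (Fin k) H hind ?_
    intro x hx
    have : x ∈ ⨅ j, (H j).normalCore := by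
      rw [Subgroup.mem_iInf]
      intro j g
      exact hx j g
    rw [hcore] at this
    simpa using this
  obtain ⟨d, hd⟩ := CE.link (p ^ n) hE
  refine (Set.finite_lt_nat d).subset ?_
  intro i hi
  by_contra h
  exact hi (hd i (by simpa using h))
end

section
/- Let p be a prime, let n ≥ 0, and let P be a Sylow p-subgroup of the symmetric group on p^n symbols. Then for every i > 0, every element of H^i(P) is annihilated by p^n. -/
namespace SylowCoh

/-- Homogeneous differential on integer valued functions of tuples. -/
def dd {X : Type} {n : ℕ} (E : (Fin n → X) → ℤ) : (Fin (n + 1) → X) → ℤ :=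
  fun x => ∑ j : Fin (n + 1), (-1) ^ (j : ℕ) * E (fun i => x (j.succAbove i))

lemma dd_cons {X : Type} {n : ℕ} (E : (Fin (n + 1) → X) → ℤ) (a : X) (x : Fin (n + 1) → X) :
    dd E (Fin.cons a x) = E x - dd (fun y => E (Fin.cons a y)) x := by
  unfold dd
  rw [Fin.sum_univ_succ, sub_eq_add_neg, ← Finset.sum_neg_distrib]
  congr 1
  · simp
  · apply Finset.sum_congr rfl
    intro j _
    have : (fun i : Fin (n + 1) => (Fin.cons a x : Fin (n + 2) → X) (j.succ.succAbove i))
        = Fin.cons a (fun i => x (j.succAbove i)) := by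
      funext i
      refine Fin.cases ?_ (fun i => ?_) i <;> simp
    rw [this]
    simp [pow_succ]

lemma dd_sub {X : Type} {n : ℕ} (E F : (Fin n → X) → ℤ) (x : Fin (n + 1) → X) :
    dd (fun y => E y - F y) x = dd E x - dd F x := by
  simp [dd, mul_sub, Finset.sum_sub_distrib]

lemma dd_mul {X : Type} {n : ℕ} (c : ℤ) (E : (Fin n → X) → ℤ) (x : Fin (n + 1) → X) :
    dd (fun y => c * E y) x = c * dd E x := by
  simp only [dd, Finset.mul_sum]
  exact Finset.sum_congr rfl fun _ _ => by ring

lemma dd_sum {X ι : Type} [Fintype ι] {n : ℕ} (E : ι → (Fin n → X) → ℤ) (x : Fin (n + 1) → X) :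
    dd (fun y => ∑ t, E t y) x = ∑ t, dd (E t) x := by
  simp only [dd, Finset.mul_sum]
  exact Finset.sum_comm

lemma dd_comp {X Y : Type} {n : ℕ} (r : X → Y) (E : (Fin n → Y) → ℤ) (x : Fin (n + 1) → X) :
    dd (fun y => E (fun i => r (y i))) x = dd E (fun i => r (x i)) := rfl

/-- The prism operator between the identity and `r`. -/
def prism {X : Type} (r : X → X) : (n : ℕ) → ((Fin (n + 1) → X) → ℤ) → (Fin n → X) → ℤ
  | 0, _, _ => 0
  | n + 1, F, x => F (Fin.cons (x 0) (fun i => r (x i)))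
      - prism r n (fun y => F (Fin.cons (x 0) y)) (Fin.tail x)

lemma prism_cons {X : Type} (r : X → X) (n : ℕ) (F : (Fin (n + 2) → X) → ℤ) (a : X)
    (x : Fin n → X) :
    prism r (n + 1) F (Fin.cons a x) =
      F (Fin.cons a (Fin.cons (r a) (fun i => r (x i))))
        - prism r n (fun y => F (Fin.cons a y)) x := by
  have : (fun i : Fin (n + 1) => r ((Fin.cons a x : Fin (n + 1) → X) i))
      = Fin.cons (r a) (fun i => r (x i)) := by
    funext i
    refine Fin.cases ?_ (fun i => ?_) i <;> simp
  simp only [prism, Fin.cons_zero, Fin.tail_cons, this]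

lemma prism_sub {X : Type} (r : X → X) : ∀ (n : ℕ) (F G : (Fin (n + 1) → X) → ℤ) (x : Fin n → X),
    prism r n (fun y => F y - G y) x = prism r n F x - prism r n G x
  | 0, F, G, x => by simp [prism]
  | n + 1, F, G, x => by
      simp only [prism]
      rw [prism_sub r n]
      ring

lemma prism_equivariant {X : Type} (r l : X → X) (h : ∀ x, r (l x) = l (r x)) :
    ∀ (n : ℕ) (F : (Fin (n + 1) → X) → ℤ) (x : Fin n → X),
    prism r n F (fun i => l (x i)) = prism r n (fun y => F (fun i => l (y i))) x
  | 0, F, x => by simp [prism]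
  | n + 1, F, x => by
      have key : ∀ (a : X) (m : ℕ) (y : Fin m → X),
          (fun i : Fin (m + 1) => l ((Fin.cons a y : Fin (m + 1) → X) i))
          = Fin.cons (l a) (fun i => l (y i)) := by
        intro a m y
        funext i
        refine Fin.cases ?_ (fun i => ?_) i <;> simp
      simp only [prism, h, key]
      congr 1
      exact prism_equivariant r l h n (fun y => F (Fin.cons (l (x 0)) y)) (Fin.tail x)

lemma prism_homotopy {X : Type} (r : X → X) : ∀ (n : ℕ) (F : (Fin (n + 1) → X) → ℤ)
    (x : Fin (n + 1) → X),
    dd (prism r n F) x + prism r (n + 1) (dd F) x = F (fun i => r (x i)) - F x := by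
  intro n
  induction n with
  | zero =>
    intro F x
    obtain ⟨a, y, rfl⟩ : ∃ a y, x = Fin.cons a y := ⟨x 0, Fin.tail x, (Fin.cons_self_tail x).symm⟩
    rw [prism_cons, dd_cons]
    have h1 : (fun i : Fin 1 => r ((Fin.cons a y : Fin 1 → X) i))
        = Fin.cons (r a) (fun i => r (y i)) := by
      funext i
      refine Fin.cases ?_ (fun i => ?_) i <;> simp
    rw [h1]
    have h2 : ∀ z : Fin 0 → X, z = y := fun z => Subsingleton.elim _ _
    simp [dd, prism, h2]
  | succ n ih =>
    intro F x
    obtain ⟨a, y, rfl⟩ : ∃ a y, x = Fin.cons a y := ⟨x 0, Fin.tail x, (Fin.cons_self_tail x).symm⟩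
    have h1 : (fun i : Fin (n + 2) => r ((Fin.cons a y : Fin (n + 2) → X) i))
        = Fin.cons (r a) (fun i => r (y i)) := by
      funext i
      refine Fin.cases ?_ (fun i => ?_) i <;> simp
    have ih' := ih (fun z => F (Fin.cons a z)) y
    rw [h1, prism_cons, dd_cons, dd_cons, dd_cons]
    simp only [prism_cons, dd_cons]
    rw [dd_sub, prism_sub,
      dd_comp r (fun z => F (Fin.cons a (Fin.cons (r a) z)))]
    linarith

/-- Invariance of a cochain under a homomorphism into the ambient group. -/
def Inv {L Γ : Type} [Group L] [Group Γ] (φ : L →* Γ) {n : ℕ} (F : (Fin n → Γ) → ℤ) : Prop :=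
  ∀ (l : L) (x : Fin n → Γ), F (fun i => φ l * x i) = F x

/-- Being the coboundary of an invariant cochain. -/
def Cob {L Γ : Type} [Group L] [Group Γ] (φ : L →* Γ) {n : ℕ} (F : (Fin (n + 1) → Γ) → ℤ) : Prop :=
  ∃ E : (Fin n → Γ) → ℤ, Inv φ E ∧ ∀ x, F x = dd E x

/-- `e` kills the kernel of the restriction from `G × K` to `G`, for all `G`. -/
def Kills (K : Type) [Group K] (e : ℕ) : Prop :=
  ∀ (G Γ : Type) [Group G] [Group Γ] (φ : G × K →* Γ), Function.Injective φ →
    ∀ (n : ℕ) (F : (Fin (n + 2) → Γ) → ℤ), Inv φ F → (∀ x, dd F x = 0) →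
      Cob (φ.comp (MonoidHom.inl G K)) F → Cob φ (fun x => (e : ℤ) * F x)

lemma Kills.of_subsingleton (K : Type) [Group K] [Subsingleton K] : Kills K 1 := by
  intro G Γ _ _ φ _ n F _ _ ⟨E, hE, h⟩
  refine ⟨E, ?_, by simpa using h⟩
  rintro ⟨g, k⟩ x
  rw [Subsingleton.elim k 1]
  exact hE g x

lemma Kills.congr {K K' : Type} [Group K] [Group K'] {e : ℕ} (f : K ≃* K') (h : Kills K e) :
    Kills K' e := by
  intro G Γ _ _ φ hφ n F hF hd ⟨E, hE, hFE⟩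
  obtain ⟨E', hE', h'⟩ := h G Γ (φ.comp ((MonoidHom.id G).prodMap f.toMonoidHom))
    (hφ.comp (Function.injective_id.prodMap f.injective)) n F (fun l x => hF _ x) hd
    ⟨E, fun g x => by simpa using hE g x, hFE⟩
  refine ⟨E', ?_, h'⟩
  rintro ⟨g, k⟩ x
  simpa using hE' (g, f.symm k) x

lemma exists_equivariant {L Γ : Type} [Group L] [Group Γ] (φ : L →* Γ)
    (hφ : Function.Injective φ) : ∃ l : Γ → L, ∀ m x, l (φ m * x) = m * l x := by
  let s : Setoid Γ := QuotientGroup.rightRel φ.range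
  have key : ∀ x : Γ, ∃ m : L, φ m = x * (Quotient.out (Quotient.mk s x))⁻¹ := by
    intro x
    have : s (Quotient.out (Quotient.mk s x)) x := Quotient.mk_out x
    exact QuotientGroup.rightRel_apply.1 this
  choose l hl using key
  refine ⟨l, fun m x => hφ ?_⟩
  have : Quotient.mk s (φ m * x) = Quotient.mk s x := by
    apply Quotient.sound
    refine QuotientGroup.rightRel_apply.2 ?_
    simp
  rw [map_mul, hl, hl, this, mul_assoc]

lemma Kills.prod {K₁ K₂ : Type} [Group K₁] [Group K₂] {e : ℕ} (h₁ : Kills K₁ e)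
    (h₂ : Kills K₂ e) : Kills (K₁ × K₂) e := by
  intro G Γ _ _ φ hφ n F hF hd hcob
  obtain ⟨l, hl⟩ := exists_equivariant φ hφ
  -- the two reorganised homomorphisms
  let a : (G × K₁) × K₂ →* G × (K₁ × K₂) := (MulEquiv.prodAssoc : (G × K₁) × K₂ ≃* _).toMonoidHom
  have ha : ∀ g k₁ k₂, a ((g, k₁), k₂) = (g, (k₁, k₂)) := fun _ _ _ => rfl
  let ψ : (G × K₁) × K₂ →* Γ := φ.comp a
  let χ : G × K₁ →* Γ := ψ.comp (MonoidHom.inl _ _)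
  have hψ : Function.Injective ψ :=
    hφ.comp (MulEquiv.prodAssoc : (G × K₁) × K₂ ≃* _).injective
  have hχv : ∀ m, χ m = φ (m.1, (m.2, 1)) := fun _ => rfl
  have hχ : Function.Injective χ := by
    intro m m' h
    rw [hχv, hχv] at h
    have := hφ h
    simp only [Prod.mk.injEq] at this
    exact Prod.ext this.1 this.2.1
  let r : Γ → Γ := fun x => χ ((l x).1, (l x).2.1)
  have hr : ∀ m x, r (φ m * x) = χ (m.1, m.2.1) * r x := by
    intro m x
    simp only [r, hl, ← map_mul]
    rfl
  obtain ⟨E, hE, hFE⟩ := h₁ G Γ χ hχ n F (fun m x => hF _ x) hd hcob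
  -- the cochain `F - r^* F`
  have hF' : Cob χ (fun x => F x - F (fun i => r (x i))) := by
    refine ⟨fun x => (-1) * prism r (n + 1) F x, ?_, ?_⟩
    · intro m x
      have := prism_equivariant r (fun y => χ m * y) (fun y => by rw [hχv, hr]; rfl) (n + 1) F x
      simp only
      rw [this]
      congr 2
      funext y
      exact hF _ y
    · intro x
      rw [dd_mul]
      have := prism_homotopy r (n + 1) F x
      have h0 : dd F = fun _ => 0 := funext hd
      have h00 : ∀ (m : ℕ) (x : Fin m → Γ), prism r m (fun _ => 0) x = 0 := by
        intro m
        induction m with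
        | zero => intro x; rfl
        | succ m ih => intro x; simp [prism, ih]
      rw [h0, h00] at this
      linarith
  obtain ⟨E', hE', hFE'⟩ := h₂ (G × K₁) Γ ψ hψ n (fun x => F x - F (fun i => r (x i)))
    (by
      intro m x
      have h1 := hF (a m) x
      have h2 : F (fun i => r (φ (a m) * x i)) = F (fun i => r (x i)) := by
        simp only [hr, hχv]
        exact hF _ _
      show F (fun i => φ (a m) * x i) - F (fun i => r (φ (a m) * x i)) = _
      rw [h1, h2])
    (by
      intro x
      rw [dd_sub, dd_comp r F, hd, hd, sub_zero]) hF'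
  refine ⟨fun x => E' x - (-1) * E (fun i => r (x i)), ?_, ?_⟩
  · rintro ⟨g, k₁, k₂⟩ x
    have h1 := hE' ((g, k₁), k₂) x
    have h2 := hE (g, k₁) (fun i => r (x i))
    have h3 : ψ ((g, k₁), k₂) = φ (g, k₁, k₂) := rfl
    rw [h3] at h1
    simp only [hr]
    rw [h1, h2]
  · intro x
    rw [dd_sub, dd_mul, dd_comp r E, ← hFE', ← hFE]
    ring

lemma Kills.pi {K : Type} [Group K] {e : ℕ} (h : Kills K e) (h1 : ∀ (U : Type) [Group U] [Subsingleton U], Kills U e)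
    (ι : Type) [Finite ι] : Kills (ι → K) e := by
  induction ι using Finite.induction_empty_option with
  | of_equiv f ih =>
    exact ih.congr
      { (Equiv.arrowCongr f (Equiv.refl K)) with map_mul' := fun _ _ => rfl }
  | h_empty => exact h1 _
  | h_option ih =>
    rename_i α _
    refine (h.prod ih).congr (MulEquiv.symm (M := Option α → K)
      { toFun := fun f => (f none, fun i => f (some i))
        invFun := fun q o => o.elim q.1 q.2
        left_inv := fun f => by funext o; cases o <;> rfl
        right_inv := fun q => rfl
        map_mul' := fun _ _ => rfl })

lemma Kills.of_dvd {K : Type} [Group K] {e e' : ℕ} (h : Kills K e) (he : e ∣ e') :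
    Kills K e' := by
  obtain ⟨c, rfl⟩ := he
  intro G Γ _ _ φ hφ n F hF hd hcob
  obtain ⟨E, hE, hFE⟩ := h G Γ φ hφ n F hF hd hcob
  refine ⟨fun x => c * E x, fun l x => by simp only [hE l x], fun x => ?_⟩
  rw [dd_mul, ← hFE]
  push_cast
  ring

lemma Kills.transfer {H K : Type} [Group H] [Group K] {e : ℕ} (f : H →* K)
    (hf : Function.Injective f) [Finite (K ⧸ f.range)] (h : Kills H e) :
    Kills K (Nat.card (K ⧸ f.range) * e) := by
  classical
  intro G Γ _ _ φ hφ n F hF hd ⟨E₀, hE₀, hFE₀⟩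
  obtain ⟨E, hE, hFE⟩ := h G Γ (φ.comp ((MonoidHom.id G).prodMap f))
    (hφ.comp (Function.injective_id.prodMap hf)) n F (fun l x => hF _ x) hd
    ⟨E₀, fun g x => by simpa using hE₀ g x, hFE₀⟩
  have hE2 : ∀ g h x, E (fun i => φ (g, f h) * x i) = E x := fun g h x => hE (g, h) x
  letI := Fintype.ofFinite (K ⧸ f.range)
  let T : K → (Fin (n + 1) → Γ) → ℤ := fun t x => E (fun i => φ (1, t⁻¹) * x i)
  have hT : ∀ t t' : K, (t : K ⧸ f.range) = t' → T t = T t' := by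
    intro t t' htt
    obtain ⟨h, hh⟩ := QuotientGroup.eq.1 htt
    funext x
    have : t' = t * f h := by rw [hh]; group
    subst this
    have := hE2 1 h⁻¹ (fun i => φ (1, t⁻¹) * x i)
    simp only [T]
    rw [← this]
    congr 1
    funext i
    rw [← mul_assoc, ← map_mul]
    simp
  refine ⟨fun x => ∑ q : K ⧸ f.range, T q.out x, ?_, ?_⟩
  · rintro ⟨g, k⟩ x
    have hg : ∀ t x, T t (fun i => φ (g, k) * x i) = T (k⁻¹ * t) x := by
      intro t x
      have hm : ∀ i, φ (1, t⁻¹) * (φ (g, k) * x i) = φ (g, f 1) * (φ (1, (k⁻¹ * t)⁻¹) * x i) := by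
        intro i
        rw [← mul_assoc, ← mul_assoc, ← map_mul, ← map_mul]
        simp
      simp only [T, hm]
      exact hE2 g 1 _
    simp only [hg]
    refine Fintype.sum_equiv (MulAction.toPerm k⁻¹) _ _ fun q => ?_
    refine congrFun (hT _ _ ?_) x
    simp only [MulAction.toPerm_apply, QuotientGroup.out_eq']
    conv_rhs => rw [← QuotientGroup.out_eq' q]
    rfl
  · intro x
    rw [dd_sum]
    have : ∀ t : K, dd (T t) x = e * F x := by
      intro t
      have h1 := dd_comp (fun y => φ (1, t⁻¹) * y) E x
      have h2 := hF (1, t⁻¹) x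
      rw [← h2]
      exact h1.trans (hFE _).symm
    simp [this, Nat.card_eq_fintype_card]
    ring

lemma kills_iterated (p : ℕ) (Q : Type) [Group Q] [Finite Q] (hQ : Nat.card Q = p) (n : ℕ) :
    Kills (IteratedWreathProduct Q n) (p ^ n) := by
  induction n with
  | zero =>
    have : Subsingleton (IteratedWreathProduct Q 0) := inferInstanceAs (Subsingleton PUnit)
    simpa using Kills.of_subsingleton (IteratedWreathProduct Q 0)
  | succ n ih =>
    have h1 := ih.pi (fun U _ _ => (Kills.of_subsingleton U).of_dvd (one_dvd _)) Q
    let f : (Q → IteratedWreathProduct Q n) →*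
        RegularWreathProduct (IteratedWreathProduct Q n) Q :=
      { toFun := fun a => ⟨a, 1⟩
        map_one' := rfl
        map_mul' := fun a b => by ext <;> simp }
    have hf : Function.Injective f := fun a b hab => congrArg RegularWreathProduct.left hab
    have hr : f.range = (RegularWreathProduct.rightHom (D := IteratedWreathProduct Q n)
        (Q := Q)).ker := by
      ext w
      rw [MonoidHom.mem_range, MonoidHom.mem_ker]
      constructor
      · rintro ⟨a, rfl⟩
        rfl
      · intro hw
        refine ⟨w.left, ?_⟩
        ext
        · rfl
        · exact hw.symm
    have hsurj : Function.Surjective (RegularWreathProduct.rightHom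
        (D := IteratedWreathProduct Q n) (Q := Q)) := fun q => ⟨⟨1, q⟩, rfl⟩
    have hcard : Nat.card (_ ⧸ f.range) = p := by
      rw [hr, ← hQ]
      exact Nat.card_congr (QuotientGroup.quotientKerEquivOfSurjective _ hsurj).toEquiv
    have h2 := h1.transfer f hf
    rw [hcard, ← pow_succ'] at h2
    exact h2

lemma dd_partialProd {G : Type} [Group G] {n : ℕ} (E : (Fin (n + 1) → G) → ℤ)
    (hE : Inv (MonoidHom.id G) E) (g : Fin (n + 1) → G) :
    dd E (Fin.partialProd g) =
      inhomogeneousCochains.d (Rep.trivial ℤ G ℤ) n (fun y => E (Fin.partialProd y)) g := by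
  rw [inhomogeneousCochains.d_hom_apply]
  unfold dd
  rw [Fin.sum_univ_succ]
  congr 1
  · have := hE (g 0) (Fin.partialProd (Fin.tail g))
    simp only [MonoidHom.id_apply, ← Fin.partialProd_succ'] at this
    simpa [Fin.tail_def] using this
  · refine Finset.sum_congr rfl fun j _ => ?_
    rw [Fin.partialProd_contractNth]
    simp
    rfl

lemma main {G : Type} [Group G] {e : ℕ} (hk : Kills G e) (n : ℕ) (f : (Fin (n + 1) → G) → ℤ)
    (hf : inhomogeneousCochains.d (Rep.trivial ℤ G ℤ) (n + 1) f = 0) :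
    ∃ u : (Fin n → G) → ℤ, ∀ g,
      inhomogeneousCochains.d (Rep.trivial ℤ G ℤ) n u g = (e : ℤ) * f g := by
  let D : (m : ℕ) → (Fin (m + 1) → G) → (Fin m → G) := fun m x i => (x i.castSucc)⁻¹ * x i.succ
  have hD : ∀ (m : ℕ) (g : Fin m → G), D m (Fin.partialProd g) = g := fun m g =>
    funext fun i => Fin.partialProd_right_inv g i
  have hD' : ∀ (m : ℕ) (x : Fin (m + 1) → G),
      (fun i => x 0 * Fin.partialProd (D m x) i) = x := fun m x => Fin.partialProd_left_inv x
  let F : (Fin (n + 2) → G) → ℤ := fun x => f (D (n + 1) x)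
  have hFI : Inv (MonoidHom.id G) F := by
    intro l x
    simp only [F, D, MonoidHom.id_apply]
    congr 1
    funext i
    group
  have hFd : ∀ x, dd F x = 0 := by
    intro x
    rw [← hD' _ x]
    have h1 := dd_comp (fun y => x 0 * y) F (Fin.partialProd (D _ x))
    rw [← h1]
    have h2 : (fun y : Fin (n + 2) → G => F (fun i => x 0 * y i)) = F :=
      funext fun y => hFI (x 0) y
    rw [h2, dd_partialProd F hFI]
    simp only [F, hD]
    exact congrFun hf _
  let φ : PUnit.{1} × G →* G := MonoidHom.snd _ _
  have hφ : Function.Injective φ := fun a b h => Prod.ext rfl h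
  obtain ⟨E, hE, hFE⟩ := hk PUnit G φ hφ n F (fun l x => hFI l.2 x) hFd
    ⟨fun x => F (Fin.cons 1 x), fun l x => by simp [φ], fun x => by
      have := hFd (Fin.cons 1 x)
      rw [dd_cons] at this
      linarith⟩
  refine ⟨fun y => E (Fin.partialProd y), fun g => ?_⟩
  rw [← dd_partialProd E (fun l x => hE (PUnit.unit, l) x), ← hFE]
  simp only [F, hD]

end SylowCoh

/-- If `P` is a Sylow `p`-subgroup of the symmetric group on `p ^ n` symbols, then `H^i(P; ℤ)`
is annihilated by `p ^ n` for every `i > 0`. -/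
theorem sylow_symmetricGroup_cohomology_exponent
    (p : ℕ) (hp : p.Prime) (n : ℕ) (P : Sylow p (Equiv.Perm (Fin (p ^ n))))
    (i : ℕ) (hi : 0 < i)
    (x : groupCohomology (Rep.trivial ℤ ↥(P : Subgroup (Equiv.Perm (Fin (p ^ n)))) ℤ) i) :
    p ^ n • x = 0 := by
  have : Fact p.Prime := ⟨hp⟩
  have hQ : Nat.card (Multiplicative (ZMod p)) = p := by simp
  have : NeZero p := ⟨hp.ne_zero⟩
  have : Finite (Multiplicative (ZMod p)) := inferInstanceAs (Finite (ZMod p))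
  have hk : SylowCoh.Kills ↥(P : Subgroup (Equiv.Perm (Fin (p ^ n)))) (p ^ n) :=
    (SylowCoh.kills_iterated p (Multiplicative (ZMod p)) hQ n).congr
      (Sylow.mulEquivIteratedWreathProduct p n (Fin (p ^ n)) (by simp)
        (Multiplicative (ZMod p)) hQ P).symm
  obtain ⟨m, rfl⟩ : ∃ m, i = m + 1 := ⟨i - 1, by omega⟩
  induction x using groupCohomology_induction_on with
  | h z =>
    let A := Rep.trivial ℤ ↥(P : Subgroup (Equiv.Perm (Fin (p ^ n)))) ℤ
    have hz : inhomogeneousCochains.d A (m + 1) (groupCohomology.iCocycles A (m + 1) z) = 0 := by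
      have := (groupCohomology.inhomogeneousCochains A).iCycles_d (m + 1) (m + 2)
      rw [groupCohomology.inhomogeneousCochains.d_def] at this
      exact congrArg (fun q => q.hom z) this
    obtain ⟨u, hu⟩ := SylowCoh.main hk m (groupCohomology.iCocycles A (m + 1) z) hz
    have hzu : p ^ n • z = groupCohomology.toCocycles A m (m + 1) u := by
      apply (ModuleCat.mono_iff_injective (groupCohomology.iCocycles A (m + 1))).1 inferInstance
      have h2 : groupCohomology.iCocycles A (m + 1) (groupCohomology.toCocycles A m (m + 1) u)
          = inhomogeneousCochains.d A m u := by
        have := (groupCohomology.inhomogeneousCochains A).toCycles_i m (m + 1)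
        rw [groupCohomology.inhomogeneousCochains.d_def] at this
        exact congrArg (fun q => q.hom u) this
      rw [h2, map_nsmul]
      funext g
      refine Eq.trans ?_ (hu g).symm
      exact nsmul_eq_mul _ _
    rw [← map_nsmul, hzu]
    have := (groupCohomology.inhomogeneousCochains A).toCycles_comp_homologyπ m (m + 1)
    exact congrArg (fun q => q.hom u) this
end
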